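/- If the NE-quadrant random-orientation model with parameter 1−p percolates, i.e. θ_NE(1−p) > 0, then the H-model with parameter p does not percolate, i.e. θ_H(p) = 0. -/

import Mathlib

open MeasureTheory ENNReal

namespace RandomOrientation

/-- One step of the base-`(p, 1-p)` expansion map on `[0,1)`. -/
noncomputable def expand (p x : ℝ) : ℝ := if x < p then x / p else (x - p) / (1 - p)

/-- The `n`-th digit of the Bernoulli(`p`) expansion of `x`: for `x` uniformly
distributed on `[0,1)` the digits are i.i.d. `{true, false}`-valued with
`P(true) = p`. -/
noncomputable def bernDigit (p : ℝ) (n : ℕ) (x : ℝ) : Bool :=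
  decide ((expand p)^[n] x < p)

/-- The product over the countable index set `I` of Bernoulli(`p`) measures on
`Bool` (`P(true) = p`), realized as the joint distribution of the digits of the
Bernoulli(`p`) expansion of a uniform random point of `[0,1)`. -/
noncomputable def bernoulliProduct (I : Type*) [Encodable I] (p : ℝ) :
    Measure (I → Bool) :=
  Measure.map (fun x i => bernDigit p (Encodable.encode i) x)
    (volume.restrict (Set.Ico (0 : ℝ) 1))

/-- Edges of `ℤ²`: `(v, false)` is the horizontal edge from `v` to `v + (1,0)`,
`(v, true)` the vertical edge from `v` to `v + (0,1)`. -/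
abbrev Edge : Type := (ℤ × ℤ) × Bool

/-- An orientation configuration of the edges of `ℤ²`. -/
abbrev Config : Type := Edge → Bool

def eSrc (e : Edge) : ℤ × ℤ := e.1

def eDst (e : Edge) : ℤ × ℤ := if e.2 then (e.1.1, e.1.2 + 1) else (e.1.1 + 1, e.1.2)

/-- The law of the random orientation with parameter `p`: each edge independently
carries the bit `true` with probability `p`. -/
noncomputable def mu (p : ℝ) : Measure Config := bernoulliProduct Edge p

/-- The directed-edge relation of Grimmett's random-orientation model:
`ω e = true` means the edge `e` is oriented in the positive coordinate direction
(rightwards resp. upwards), `ω e = false` in the negative one. -/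
def gStep (ω : Config) (u v : ℤ × ℤ) : Prop :=
  ∃ e : Edge, (eSrc e = u ∧ eDst e = v ∧ ω e = true) ∨ (eSrc e = v ∧ eDst e = u ∧ ω e = false)

/-- Squared euclidean norm on `ℤ²`. -/
def normSq (v : ℤ × ℤ) : ℤ := v.1 ^ 2 + v.2 ^ 2

/-- The directed-edge relation of the H-model: `ω e = true` means the edge `e` is
oriented away from the origin, i.e. towards its endpoint of larger euclidean norm
(adjacent vertices of `ℤ²` never have equal norms). -/
def hStep (ω : Config) (u v : ℤ × ℤ) : Prop :=
  ∃ e : Edge, ((eSrc e = u ∧ eDst e = v) ∨ (eSrc e = v ∧ eDst e = u)) ∧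
    ω e = decide (normSq u < normSq v)

/-- There is an infinite directed self-avoiding path starting at the origin,
all of whose vertices lie in `S`, for the directed-step relation `R`. -/
def percolates (R : ℤ × ℤ → ℤ × ℤ → Prop) (S : Set (ℤ × ℤ)) : Prop :=
  ∃ γ : ℕ → ℤ × ℤ, γ 0 = (0, 0) ∧ Function.Injective γ ∧
    (∀ n, R (γ n) (γ (n + 1))) ∧ ∀ n, γ n ∈ S

/-- The (closed) North-East quadrant of `ℤ²`. -/
def NEquad : Set (ℤ × ℤ) := {v | 0 ≤ v.1 ∧ 0 ≤ v.2}

/-- `θ_H(p)`: percolation probability of the H-model with parameter `p`. -/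
noncomputable def thetaH (p : ℝ) : ℝ≥0∞ := mu p {ω | percolates (hStep ω) Set.univ}

/-- `θ_NE(p)`: probability of an infinite directed self-avoiding path from the
origin staying in the North-East quadrant, in the random-orientation model. -/
noncomputable def thetaNE (p : ℝ) : ℝ≥0∞ := mu p {ω | percolates (gStep ω) NEquad}

/-- `θ_G(p)`: percolation probability of Grimmett's random-orientation model. -/
noncomputable def thetaG (p : ℝ) : ℝ≥0∞ := mu p {ω | percolates (gStep ω) Set.univ}

open ProbabilityTheory

/-- The Bernoulli(`p`) law on `Bool`. -/
noncomputable def bern (p : ℝ) : Measure Bool :=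
  ENNReal.ofReal p • Measure.dirac true + ENNReal.ofReal (1 - p) • Measure.dirac false

lemma isProbabilityMeasure_bern {p : ℝ} (hp0 : 0 ≤ p) (hp1 : p ≤ 1) :
    IsProbabilityMeasure (bern p) := by
  constructor
  simp [bern, ← ENNReal.ofReal_add hp0 (sub_nonneg.2 hp1)]

lemma bern_apply (p : ℝ) (W : Set Bool) [Decidable (true ∈ W)] [Decidable (false ∈ W)] :
    bern p W = (if true ∈ W then ENNReal.ofReal p else 0) +
      (if false ∈ W then ENNReal.ofReal (1 - p) else 0) := by
  simp [bern, Set.indicator_apply]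

lemma measurable_expand (p : ℝ) : Measurable (expand p) := by
  unfold expand
  exact Measurable.ite measurableSet_Iio (by fun_prop) (by fun_prop)

lemma measurable_bernDigit (p : ℝ) (n : ℕ) : Measurable (bernDigit p n) := by
  refine measurable_to_bool ?_
  have : bernDigit p n ⁻¹' {true} = (expand p)^[n] ⁻¹' Set.Iio p := by
    ext x; simp [bernDigit]
  rw [this]
  exact (measurable_expand p).iterate n measurableSet_Iio

lemma volume_expand_lower {p : ℝ} (hp0 : 0 ≤ p) (hp1 : p ≤ 1) (B : Set ℝ) :
    volume ({x | x < p ∧ expand p x ∈ B} ∩ Set.Ico (0 : ℝ) 1) =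
      ENNReal.ofReal p * volume (B ∩ Set.Ico (0 : ℝ) 1) := by
  rcases hp0.eq_or_lt with rfl | hp
  · simp only [ofReal_zero, zero_mul]
    convert measure_empty (μ := (volume : Measure ℝ))
    ext x; simp only [Set.mem_inter_iff, Set.mem_ofPred_eq, Set.mem_Ico, Set.mem_empty_iff_false,
      iff_false]
    rintro ⟨⟨h, -⟩, h', -⟩; linarith
  · have : {x | x < p ∧ expand p x ∈ B} ∩ Set.Ico (0 : ℝ) 1 =
        (p⁻¹ * ·) ⁻¹' (B ∩ Set.Ico (0 : ℝ) 1) := by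
      ext x
      have h1 : 0 ≤ p⁻¹ * x ↔ 0 ≤ x := by
        rw [inv_mul_eq_div, le_div_iff₀ hp, zero_mul]
      have h2 : p⁻¹ * x < 1 ↔ x < p := by
        rw [inv_mul_eq_div, div_lt_iff₀ hp, one_mul]
      simp only [Set.mem_inter_iff, Set.mem_ofPred_eq, Set.mem_Ico, Set.mem_preimage, h1, h2]
      by_cases hx : x < p
      · simp only [expand, hx, if_true, div_eq_inv_mul, true_and, and_true]
        have : x < 1 := by linarith
        tauto
      · tauto
    rw [this, Real.volume_preimage_mul_left (inv_ne_zero hp.ne')]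
    simp [abs_of_pos hp]

lemma volume_expand_upper {p : ℝ} (hp0 : 0 ≤ p) (hp1 : p ≤ 1) (B : Set ℝ) :
    volume ({x | ¬ x < p ∧ expand p x ∈ B} ∩ Set.Ico (0 : ℝ) 1) =
      ENNReal.ofReal (1 - p) * volume (B ∩ Set.Ico (0 : ℝ) 1) := by
  rcases hp1.eq_or_lt with rfl | hp
  · simp only [sub_self, ofReal_zero, zero_mul]
    convert measure_empty (μ := (volume : Measure ℝ))
    ext x; simp only [Set.mem_inter_iff, Set.mem_ofPred_eq, Set.mem_Ico, Set.mem_empty_iff_false,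
      iff_false]
    rintro ⟨⟨h, -⟩, h', h''⟩; exact h h''
  · have hq : 0 < 1 - p := by linarith
    have : {x | ¬ x < p ∧ expand p x ∈ B} ∩ Set.Ico (0 : ℝ) 1 =
        (fun x => x + -p) ⁻¹' (((1 - p)⁻¹ * ·) ⁻¹' (B ∩ Set.Ico (0 : ℝ) 1)) := by
      ext x
      have h1 : 0 ≤ (1 - p)⁻¹ * (x + -p) ↔ ¬ x < p := by
        rw [inv_mul_eq_div, le_div_iff₀ hq, zero_mul, not_lt, ← sub_eq_add_neg, sub_nonneg]
      have h2 : (1 - p)⁻¹ * (x + -p) < 1 ↔ x < 1 := by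
        rw [inv_mul_eq_div, div_lt_iff₀ hq, one_mul]
        constructor <;> intro <;> linarith
      simp only [Set.mem_inter_iff, Set.mem_ofPred_eq, Set.mem_Ico, Set.mem_preimage, h1, h2]
      by_cases hx : x < p
      · tauto
      · simp only [expand, hx, if_false, div_eq_inv_mul, ← sub_eq_add_neg, not_false_eq_true, true_and]
        have : 0 ≤ x := by linarith
        tauto
    rw [this, measure_preimage_add_right, Real.volume_preimage_mul_left (inv_ne_zero hq.ne')]
    simp [abs_of_pos hq]

/-- The digits of a uniform point together with the remainder are independent. -/
lemma volume_digits {p : ℝ} (hp0 : 0 ≤ p) (hp1 : p ≤ 1) (W : ℕ → Set Bool) (n : ℕ) (B : Set ℝ)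
    (hB : MeasurableSet B) :
    volume ({x | (∀ i < n, bernDigit p i x ∈ W i) ∧ (expand p)^[n] x ∈ B} ∩ Set.Ico (0 : ℝ) 1) =
      (∏ i ∈ Finset.range n, bern p (W i)) * volume (B ∩ Set.Ico (0 : ℝ) 1) := by
  classical
  induction n generalizing B with
  | zero => simp
  | succ n ih =>
    have hset : {x | (∀ i < n + 1, bernDigit p i x ∈ W i) ∧ (expand p)^[n + 1] x ∈ B} =
        {x | (∀ i < n, bernDigit p i x ∈ W i) ∧
          (expand p)^[n] x ∈ {y | decide (y < p) ∈ W n ∧ expand p y ∈ B}} := by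
      ext x
      simp only [Set.mem_ofPred_eq, Function.iterate_succ_apply', Nat.lt_succ_iff_lt_or_eq, or_imp,
        forall_and, forall_eq, and_assoc]
      rfl
    have hlow : MeasurableSet {y | y < p ∧ expand p y ∈ B} :=
      measurableSet_Iio.inter (measurable_expand p hB)
    have hupp : MeasurableSet {y | ¬ y < p ∧ expand p y ∈ B} :=
      measurableSet_Iio.compl.inter (measurable_expand p hB)
    have hsplit : {y | decide (y < p) ∈ W n ∧ expand p y ∈ B} =
        (if true ∈ W n then {y | y < p ∧ expand p y ∈ B} else ∅) ∪
        (if false ∈ W n then {y | ¬ y < p ∧ expand p y ∈ B} else ∅) := by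
      ext y
      by_cases hy : y < p <;> by_cases h1 : true ∈ W n <;> by_cases h2 : false ∈ W n <;>
        simp [-not_lt, hy, h1, h2]
    have hm1 : MeasurableSet (if true ∈ W n then {y | y < p ∧ expand p y ∈ B} else ∅) := by
      split_ifs
      exacts [hlow, .empty]
    have hm2 : MeasurableSet (if false ∈ W n then {y | ¬ y < p ∧ expand p y ∈ B} else ∅) := by
      split_ifs
      exacts [hupp, .empty]
    rw [hset, ih _ (by rw [hsplit]; exact hm1.union hm2), Finset.prod_range_succ, mul_assoc]
    congr 1
    rw [hsplit, Set.union_inter_distrib_right, measure_union _ (hm2.inter measurableSet_Ico),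
      bern_apply, add_mul]
    · congr 1
      · split_ifs <;> simp [volume_expand_lower hp0 hp1]
      · split_ifs <;> simp [-not_lt, volume_expand_upper hp0 hp1]
    · refine Disjoint.mono Set.inter_subset_left Set.inter_subset_left ?_
      rw [Set.disjoint_left]
      intro y
      split_ifs <;> simp [-not_lt]
      tauto

/-- `bernoulliProduct` is the product measure. -/
lemma bernoulliProduct_eq {I : Type*} [Encodable I] {p : ℝ} (hp0 : 0 ≤ p) (hp1 : p ≤ 1) :
    bernoulliProduct I p = Measure.infinitePi (fun _ : I => bern p) := by
  classical
  have := isProbabilityMeasure_bern hp0 hp1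
  refine Measure.eq_infinitePi _ fun s t _ => ?_
  rw [bernoulliProduct, Measure.map_apply
    (measurable_pi_iff.2 fun i => measurable_bernDigit p _)
    (MeasurableSet.pi s.countable_toSet fun i _ => .of_discrete),
    Measure.restrict_apply' measurableSet_Ico]
  obtain ⟨n, hn⟩ : ∃ n, ∀ e ∈ s, Encodable.encode e < n :=
    ⟨s.sup Encodable.encode + 1, fun e he => Nat.lt_succ_of_le (Finset.le_sup he)⟩
  set W : ℕ → Set Bool := fun i => {b | ∀ e ∈ s, Encodable.encode e = i → b ∈ t e} with hW
  have h := volume_digits hp0 hp1 W n Set.univ .univ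
  have hset : (fun x (i : I) => bernDigit p (Encodable.encode i) x) ⁻¹' (s : Set I).pi t =
      {x | (∀ i < n, bernDigit p i x ∈ W i) ∧ (expand p)^[n] x ∈ Set.univ} := by
    ext x
    simp only [Set.mem_preimage, Set.mem_pi, Finset.mem_coe, Set.mem_univ, and_true,
      Set.mem_ofPred_eq, hW]
    constructor
    · rintro hx i - e he rfl
      exact hx e he
    · intro hx e he
      exact hx _ (hn e he) e he rfl
  rw [hset, h]
  simp only [Set.univ_inter, Real.volume_Ico, sub_zero, ofReal_one, mul_one]
  have himg : ∏ i ∈ s.image Encodable.encode, bern p (W i) = ∏ e ∈ s, bern p (t e) := by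
    rw [Finset.prod_image fun a _ b _ h => Encodable.encode_injective h]
    refine Finset.prod_congr rfl fun e he => ?_
    congr 1
    ext b
    simp only [hW, Set.mem_ofPred_eq]
    constructor
    · exact fun h => h e he rfl
    · intro h e' he' hee
      rwa [Encodable.encode_injective hee]
  rw [← himg]
  refine (Finset.prod_subset ?_ ?_).symm
  · intro i hi
    obtain ⟨e, he, rfl⟩ := Finset.mem_image.1 hi
    exact Finset.mem_range.2 (hn e he)
  · intro i _ hi
    have : W i = Set.univ := by
      ext b
      simp only [hW, Set.mem_ofPred_eq, Set.mem_univ, iff_true]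
      rintro e he rfl
      exact absurd (Finset.mem_image_of_mem _ he) hi
    rw [this, measure_univ]

/-- The event `X` is determined by the coordinates in `S`. -/
def DeterminedBy {I : Type*} (X : Set (I → Bool)) (S : Set I) : Prop :=
  ∀ ω ω' : I → Bool, (∀ i ∈ S, ω i = ω' i) → ω ∈ X → ω' ∈ X

namespace DeterminedBy

variable {I : Type*} {X Y : Set (I → Bool)} {S T : Set I}

lemma mono (h : DeterminedBy X S) (hST : S ⊆ T) : DeterminedBy X T :=
  fun ω ω' hω => h ω ω' fun i hi => hω i (hST hi)

lemma compl (h : DeterminedBy X S) : DeterminedBy Xᶜ S :=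
  fun ω ω' hω hX hX' => hX (h ω' ω (fun i hi => (hω i hi).symm) hX')

lemma inter (hX : DeterminedBy X S) (hY : DeterminedBy Y S) : DeterminedBy (X ∩ Y) S :=
  fun ω ω' hω h => ⟨hX ω ω' hω h.1, hY ω ω' hω h.2⟩

lemma iInter {ι : Sort*} {X : ι → Set (I → Bool)} (h : ∀ j, DeterminedBy (X j) S) :
    DeterminedBy (⋂ j, X j) S :=
  fun ω ω' hω hX => Set.mem_iInter.2 fun j => h j ω ω' hω (Set.mem_iInter.1 hX j)

lemma iUnion {ι : Sort*} {X : ι → Set (I → Bool)} (h : ∀ j, DeterminedBy (X j) S) :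
    DeterminedBy (⋃ j, X j) S := fun ω ω' hω hX => by
  obtain ⟨j, hj⟩ := Set.mem_iUnion.1 hX
  exact Set.mem_iUnion.2 ⟨j, h j ω ω' hω hj⟩

lemma disjointed {X : ℕ → Set (I → Bool)} (h : ∀ j, DeterminedBy (X j) S) (n : ℕ) :
    DeterminedBy (disjointed X n) S := by
  rw [disjointed_eq_inter_compl]
  exact (h n).inter (iInter fun j => iInter fun _ => (h j).compl)

lemma measurableSet_iSup (h : DeterminedBy X S) (hX : MeasurableSet X) :
    MeasurableSet[⨆ i ∈ S, MeasurableSpace.comap (fun ω : I → Bool => ω i) inferInstance] X := by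
  classical
  have heq : X = (fun (ω : I → Bool) i => if i ∈ S then ω i else false) ⁻¹' X := by
    ext ω
    exact ⟨h _ _ fun i hi => by simp [hi], h _ _ fun i hi => by simp [hi]⟩
  have hm : Measurable[⨆ i ∈ S, MeasurableSpace.comap (fun ω : I → Bool => ω i) inferInstance]
      (fun (ω : I → Bool) i => if i ∈ S then ω i else false) := by
    refine @measurable_pi_lambda _ _ _ (_) _ _ fun i => ?_
    by_cases hi : i ∈ S
    · simp only [hi, if_true]
      refine Measurable.mono (comap_measurable fun ω : I → Bool => ω i) ?_ le_rfl
      exact le_iSup₂ (f := fun i (_ : i ∈ S) =>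
        MeasurableSpace.comap (fun ω : I → Bool => ω i) inferInstance) i hi
    · simp only [hi, if_false]
      exact measurable_const
  rw [heq]
  exact hm hX

end DeterminedBy

section Product

variable {I : Type*} {ν : I → Measure Bool} [∀ i, IsProbabilityMeasure (ν i)]

lemma iIndep_coordinates :
    iIndep (fun i => MeasurableSpace.comap (fun ω : I → Bool => ω i) inferInstance)
      (Measure.infinitePi ν) :=
  iIndepFun_infinitePi (X := fun _ b => b) fun _ => measurable_id

lemma measure_inter_of_disjoint {X Y : Set (I → Bool)} {S T : Set I} (hST : Disjoint S T)
    (hX : MeasurableSet X) (hXS : DeterminedBy X S)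
    (hY : MeasurableSet Y) (hYT : DeterminedBy Y T) :
    Measure.infinitePi ν (X ∩ Y) = Measure.infinitePi ν X * Measure.infinitePi ν Y :=
  (Indep_iff _ _ _).1 (indep_iSup_of_disjoint (fun i => (measurable_pi_apply i).comap_le)
    (iIndep_coordinates (ν := ν)) hST) X Y (hXS.measurableSet_iSup hX) (hYT.measurableSet_iSup hY)

/-- If `Z n` has probability at least `c` for each `n` and is independent of the family `Y`, then
`Z` occurs at the first index for which `Y` occurs with probability at least `c`. -/
lemma mul_le_measure_iUnion_inter {Y Z : ℕ → Set (I → Bool)} {S T : Set I} (hST : Disjoint S T)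
    (hY : ∀ n, MeasurableSet (Y n)) (hYS : ∀ n, DeterminedBy (Y n) S)
    (hZ : ∀ n, MeasurableSet (Z n)) (hZT : ∀ n, DeterminedBy (Z n) T) {c : ℝ≥0∞}
    (hc : ∀ n, c ≤ Measure.infinitePi ν (Z n)) :
    Measure.infinitePi ν (⋃ n, Y n) * c ≤ Measure.infinitePi ν (⋃ n, Y n ∩ Z n) := by
  have hmeas : ∀ n, MeasurableSet (disjointed Y n) := fun n => MeasurableSet.disjointed hY n
  calc Measure.infinitePi ν (⋃ n, Y n) * c
      = ∑' n, Measure.infinitePi ν (disjointed Y n) * c := by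
        rw [← iUnion_disjointed, measure_iUnion (disjoint_disjointed Y) hmeas, ENNReal.tsum_mul_right]
    _ ≤ ∑' n, Measure.infinitePi ν (disjointed Y n ∩ Z n) := by
        refine ENNReal.tsum_le_tsum fun n => ?_
        rw [measure_inter_of_disjoint hST (hmeas n) (.disjointed hYS n) (hZ n) (hZT n)]
        gcongr
        exact hc n
    _ = Measure.infinitePi ν (⋃ n, disjointed Y n ∩ Z n) := by
        refine (measure_iUnion (fun i j hij => ?_) fun n => (hmeas n).inter (hZ n)).symm
        exact (disjoint_disjointed Y hij).mono Set.inter_subset_left Set.inter_subset_left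
    _ ≤ _ := by
        refine measure_mono (Set.iUnion_mono fun n => ?_)
        exact Set.inter_subset_inter_left _ (disjointed_subset Y n)

/-- Among infinitely many independent events of probability bounded below one occurs surely. -/
lemma measure_iUnion_eq_one {Y : ℕ → Set (I → Bool)} {S : ℕ → Set I}
    (hS : Pairwise (Function.onFun Disjoint S))
    (hY : ∀ n, MeasurableSet (Y n)) (hYS : ∀ n, DeterminedBy (Y n) (S n)) {c : ℝ≥0∞}
    (hc0 : c ≠ 0) (hc : ∀ n, c ≤ Measure.infinitePi ν (Y n)) :
    Measure.infinitePi ν (⋃ n, Y n) = 1 := by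
  have hbound : ∀ n, Measure.infinitePi ν (⋂ i < n, (Y i)ᶜ) ≤ (1 - c) ^ n := by
    intro n
    induction n with
    | zero => simp
    | succ n ih =>
      have hset : (⋂ i < n + 1, (Y i)ᶜ) = (⋂ i < n, (Y i)ᶜ) ∩ (Y n)ᶜ := by
        ext ω
        simp only [Set.mem_iInter, Set.mem_inter_iff, Nat.lt_succ_iff_lt_or_eq, or_imp, forall_and,
          forall_eq]
      rw [hset, measure_inter_of_disjoint (S := ⋃ i < n, S i) (T := S n), pow_succ]
      · gcongr
        rw [prob_compl_eq_one_sub (hY n)]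
        exact tsub_le_tsub_left (hc n) 1
      · simp only [Set.disjoint_iUnion_left]
        exact fun i hi => hS hi.ne
      · exact .iInter fun i => .iInter fun _ => (hY i).compl
      · exact .iInter fun i => .iInter fun hi => ((hYS i).mono
          (Set.subset_biUnion_of_mem (u := S) (show i ∈ {j | j < n} from hi))).compl
      · exact (hY n).compl
      · exact (hYS n).compl
  rw [← prob_compl_eq_zero_iff (.iUnion hY), Set.compl_iUnion]
  have hlt : 1 - c < 1 := ENNReal.sub_lt_self one_ne_top one_ne_zero hc0
  refine le_antisymm (ge_of_tendsto' (ENNReal.tendsto_pow_atTop_nhds_zero_of_lt_one hlt)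
    fun n => (measure_mono ?_).trans (hbound n)) zero_le
  exact Set.iInter_mono fun i => Set.subset_iInter fun _ => le_rfl

/-- Kolmogorov's zero-one law for events insensitive to finitely many coordinates. -/
lemma measure_eq_zero_or_one_of_tail {X : Set (I → Bool)} (hX : MeasurableSet X)
    (h : ∀ F : Finset I, DeterminedBy X (F : Set I)ᶜ) :
    Measure.infinitePi ν X = 0 ∨ Measure.infinitePi ν X = 1 := by
  classical
  refine measure_zero_or_one_of_measurableSet_limsup (f := Filter.cofinite)
    (s := fun i => MeasurableSpace.comap (fun ω : I → Bool => ω i) inferInstance)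
    (p := fun t : Set I => t.Finite) (ns := fun F : Finset I => (F : Set I))
    (fun i => (measurable_pi_apply i).comap_le)
    (iIndep_coordinates (ν := ν)) ?_ ?_ ?_ ?_ ?_
  · intro t ht
    simpa using ht
  · exact Monotone.directed_le fun F G hFG => by simpa using hFG
  · exact fun F => F.finite_toSet
  · exact fun i => ⟨{i}, by simp⟩
  · rw [Filter.HasBasis.limsup_eq_iInf_iSup Filter.hasBasis_cofinite]
    rw [MeasurableSpace.measurableSet_iInf]
    intro t
    rw [MeasurableSpace.measurableSet_iInf]
    intro ht
    refine DeterminedBy.measurableSet_iSup ?_ hX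
    simpa using h ht.toFinset

end Product

section Bernoulli

variable {I : Type*}

lemma map_bern_not (p : ℝ) : (bern p).map (fun b => !b) = bern (1 - p) := by
  classical
  ext W hW
  rw [Measure.map_apply .of_discrete hW, bern_apply, bern_apply]
  simp [add_comm]

lemma measure_preimage_reindex {p : ℝ} (hp0 : 0 ≤ p) (hp1 : p ≤ 1) {σ : I → I}
    (hσ : Function.Injective σ) {X : Set (I → Bool)} (hX : MeasurableSet X) :
    Measure.infinitePi (fun _ : I => bern p) ((fun ω i => ω (σ i)) ⁻¹' X) =
      Measure.infinitePi (fun _ : I => bern p) X := by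
  have := isProbabilityMeasure_bern hp0 hp1
  rw [← Measure.map_apply (by fun_prop) hX, Measure.map_infinitePi_infinitePi_of_inj hσ]

lemma measure_preimage_reindex_not {p : ℝ} (hp0 : 0 ≤ p) (hp1 : p ≤ 1) {σ : I → I}
    (hσ : Function.Injective σ) {X : Set (I → Bool)} (hX : MeasurableSet X) :
    Measure.infinitePi (fun _ : I => bern p) ((fun ω i => !ω (σ i)) ⁻¹' X) =
      Measure.infinitePi (fun _ : I => bern (1 - p)) X := by
  have := isProbabilityMeasure_bern hp0 hp1
  have hn : Measurable fun (ω : I → Bool) i => !ω i :=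
    measurable_pi_iff.2 fun i => (Measurable.of_discrete (f := not)).comp (measurable_pi_apply i)
  have h1 : (fun (ω : I → Bool) i => !ω (σ i)) ⁻¹' X =
      (fun ω i => ω (σ i)) ⁻¹' ((fun (ω : I → Bool) i => !ω i) ⁻¹' X) := rfl
  rw [h1, measure_preimage_reindex hp0 hp1 hσ (hn hX), ← Measure.map_apply hn hX,
    Measure.infinitePi_map_pi (fun _ : I => bern p) (f := fun _ b => !b) fun _ => .of_discrete,
    map_bern_not]

end Bernoulli

lemma DeterminedBy.measurableSet {I : Type*} {X : Set (I → Bool)} {G : Finset I}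
    (h : DeterminedBy X G) : MeasurableSet X := by
  have heq : X = G.restrict ⁻¹' (G.restrict '' X) := by
    refine Set.Subset.antisymm (Set.subset_preimage_image _ _) ?_
    rintro ω ⟨ω', hω', hr⟩
    exact h ω' ω (fun i hi => congrFun hr ⟨i, hi⟩) hω'
  rw [heq]
  exact Finset.measurable_restrict G (Set.toFinite _).measurableSet

section Separation

variable {V E : Type*}

/-- The vertex set `A` is not left through the edge `e`, where the edge `e` is oriented from `s e`
to `t e` if `ω e = true` and from `t e` to `s e` otherwise. -/
def ClosedAt (s t : E → V) (ω : E → Bool) (A : Set V) (e : E) : Prop :=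
  (ω e = true → s e ∈ A → t e ∈ A) ∧ (ω e = false → t e ∈ A → s e ∈ A)

/-- Some vertex set containing `S` and avoiding `B` is not left through any edge of `G`. -/
def separated (s t : E → V) (G : Set E) (S B : Set V) : Set (E → Bool) :=
  {ω | ∃ A : Set V, S ⊆ A ∧ Disjoint A B ∧ ∀ e ∈ G, ClosedAt s t ω A e}

variable {s t : E → V}

lemma ClosedAt.congr {ω ω' : E → Bool} {A : Set V} {e : E} (h : ClosedAt s t ω A e)
    (he : ω e = ω' e) : ClosedAt s t ω' A e := by
  rwa [ClosedAt, ← he]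

lemma closedAt_compl {ω : E → Bool} {A : Set V} {e : E} :
    ClosedAt t s ω Aᶜ e ↔ ClosedAt s t ω A e := by
  simp only [ClosedAt, Set.mem_compl_iff, not_imp_not]

lemma determinedBy_separated (G : Set E) (S B : Set V) :
    DeterminedBy (separated s t G S B) G := by
  rintro ω ω' hω ⟨A, hS, hB, hA⟩
  exact ⟨A, hS, hB, fun e he => (hA e he).congr (hω e he)⟩

lemma separated_swap (G : Set E) (S B : Set V) :
    separated s t G S B = separated t s G B S := by
  ext ω
  constructor
  · rintro ⟨A, hS, hB, hA⟩
    exact ⟨Aᶜ, hB.subset_compl_left, Set.disjoint_compl_left_iff_subset.2 hS,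
      fun e he => closedAt_compl.2 (hA e he)⟩
  · rintro ⟨A, hS, hB, hA⟩
    exact ⟨Aᶜ, hB.subset_compl_left, Set.disjoint_compl_left_iff_subset.2 hS,
      fun e he => closedAt_compl.2 (hA e he)⟩

lemma separated_anti {G G' : Set E} {S S' B : Set V} (hG : G' ⊆ G) (hS : S' ⊆ S) :
    separated s t G S B ⊆ separated s t G' S' B := by
  rintro ω ⟨A, hSA, hB, hA⟩
  exact ⟨A, hS.trans hSA, hB, fun e he => hA e (hG he)⟩

variable {ν : E → Measure Bool} [∀ i, IsProbabilityMeasure (ν i)]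

/-- Revealing an edge with an endpoint `u` in the source set `S`. -/
lemma measureReal_separated_insert [DecidableEq E] {G : Finset E} {S B : Set V} {e : E}
    (he : e ∉ G) {u v : V} (b : Bool)
    (huv : ∀ ω A, ClosedAt s t ω A e ↔ (ω e = b → u ∈ A → v ∈ A) ∧ (ω e = !b → v ∈ A → u ∈ A))
    (hu : u ∈ S) :
    (Measure.infinitePi ν).real (separated s t (insert e G : Finset E) S B) =
      (Measure.infinitePi ν).real {ω | ω e = b} *
        (Measure.infinitePi ν).real (separated s t G (insert v S) B) +
      (1 - (Measure.infinitePi ν).real {ω | ω e = b}) *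
        (Measure.infinitePi ν).real (separated s t G S B) := by
  have hb : MeasurableSet {ω : E → Bool | ω e = b} :=
    measurableSet_eq_fun (measurable_pi_apply e) measurable_const
  have hbdet : DeterminedBy {ω : E → Bool | ω e = b} {e} :=
    fun ω ω' h hω => (h e rfl).symm.trans hω
  have hdisj : Disjoint ({e} : Set E) G := by simpa using he
  have hsep : ∀ S', MeasurableSet (separated s t G S' B) :=
    fun S' => (determinedBy_separated (G : Set E) S' B).measurableSet
  have h1 : separated s t (insert e G : Finset E) S B ∩ {ω | ω e = b} =
      {ω | ω e = b} ∩ separated s t G (insert v S) B := by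
    ext ω
    constructor
    · rintro ⟨⟨A, hS, hB, hA⟩, hω⟩
      refine ⟨hω, A, Set.insert_subset ?_ hS, hB, fun e' he' => hA e' (by simp_all)⟩
      exact ((huv ω A).1 (hA e (by simp))).1 hω (hS hu)
    · rintro ⟨hω, A, hS, hB, hA⟩
      refine ⟨⟨A, (Set.subset_insert _ _).trans hS, hB, ?_⟩, hω⟩
      intro e' he'
      rw [Finset.coe_insert, Set.mem_insert_iff] at he'
      rcases he' with rfl | he'
      · rw [huv]
        exact ⟨fun _ _ => hS (Set.mem_insert _ _), fun _ _ => hS (Set.mem_insert_of_mem _ hu)⟩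
      · exact hA e' he'
  have h2 : separated s t (insert e G : Finset E) S B \ {ω | ω e = b} =
      {ω | ω e = b}ᶜ ∩ separated s t G S B := by
    ext ω
    constructor
    · rintro ⟨⟨A, hS, hB, hA⟩, hω⟩
      exact ⟨hω, A, hS, hB, fun e' he' => hA e' (by simp_all)⟩
    · rintro ⟨hω, A, hS, hB, hA⟩
      refine ⟨⟨A, hS, hB, ?_⟩, hω⟩
      intro e' he'
      rw [Finset.coe_insert, Set.mem_insert_iff] at he'
      rcases he' with rfl | he'
      · rw [huv]
        exact ⟨fun h => absurd h hω, fun _ _ => hS hu⟩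
      · exact hA e' he'
  rw [← measureReal_inter_add_sdiff (t := {ω | ω e = b}) hb, h1, h2, ← probReal_compl_eq_one_sub hb]
  simp only [measureReal_def]
  rw [measure_inter_of_disjoint hdisj hb hbdet (hsep _) (determinedBy_separated _ _ _),
    measure_inter_of_disjoint hdisj hb.compl hbdet.compl (hsep _) (determinedBy_separated _ _ _),
    ENNReal.toReal_mul, ENNReal.toReal_mul]

lemma weighted_mul_le {a x y x' y' : ℝ} (ha0 : 0 ≤ a) (ha1 : a ≤ 1) (hx : x ≤ y) (hx' : x' ≤ y') :
    (a * x + (1 - a) * y) * (a * x' + (1 - a) * y') ≤ a * (x * x') + (1 - a) * (y * y') := by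
  nlinarith [mul_nonneg (mul_nonneg ha0 (sub_nonneg.2 ha1))
    (mul_nonneg (sub_nonneg.2 hx) (sub_nonneg.2 hx'))]

/-- The events that two source sets are separated from `B` are positively correlated in the sense
that both are separated with probability at least the product. -/
lemma measureReal_separated_mul_le (G : Finset E) (S₁ S₂ B : Set V) :
    (Measure.infinitePi ν).real (separated s t G S₁ B) *
      (Measure.infinitePi ν).real (separated s t G S₂ B) ≤
    (Measure.infinitePi ν).real (separated s t G (S₁ ∪ S₂) B) := by
  classical
  induction hn : G.card generalizing G S₁ S₂ with
  | zero =>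
    obtain rfl := Finset.card_eq_zero.1 hn
    by_cases h : Disjoint S₁ B
    · refine (mul_le_of_le_one_left measureReal_nonneg measureReal_le_one).trans
        (measureReal_mono ?_)
      rintro ω ⟨A, hS, hB, -⟩
      exact ⟨S₁ ∪ A, Set.union_subset_union_right _ hS, h.union_left hB, by simp⟩
    · have : separated s t (∅ : Finset E) S₁ B = ∅ := by
        ext ω
        simp only [separated, Set.mem_ofPred_eq, Set.mem_empty_iff_false, iff_false]
        rintro ⟨A, hS, hB, -⟩
        exact h (hB.mono_left hS)
      rw [this, measureReal_empty, zero_mul]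
      exact measureReal_nonneg
  | succ n ih =>
    by_cases hex : ∃ e ∈ G, s e ∈ S₁ ∨ t e ∈ S₁
    · obtain ⟨e, heG, he⟩ := hex
      obtain ⟨u, v, b, hu, huv⟩ : ∃ u v b, u ∈ S₁ ∧ ∀ ω A, ClosedAt s t ω A e ↔
          (ω e = b → u ∈ A → v ∈ A) ∧ (ω e = !b → v ∈ A → u ∈ A) := by
        rcases he with he | he
        · exact ⟨s e, t e, true, he, fun ω A => by simp [ClosedAt]⟩
        · exact ⟨t e, s e, false, he, fun ω A => by simp [ClosedAt, and_comm]⟩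
      have hnot : e ∉ G.erase e := Finset.notMem_erase e G
      have hG : insert e (G.erase e) = G := Finset.insert_erase heG
      have hcard : (G.erase e).card = n := by rw [Finset.card_erase_of_mem heG, hn]; rfl
      have e1 := measureReal_separated_insert (ν := ν) (B := B) hnot b huv hu
      have e12 := measureReal_separated_insert (ν := ν) (S := S₁ ∪ S₂) (B := B) hnot b huv
        (Or.inl hu)
      rw [hG] at e1 e12
      rw [e1, e12]
      set a := (Measure.infinitePi ν).real {ω | ω e = b}
      have ha0 : 0 ≤ a := measureReal_nonneg
      have ha1 : a ≤ 1 := measureReal_le_one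
      by_cases hu2 : u ∈ S₂
      · have e2 := measureReal_separated_insert (ν := ν) (B := B) hnot b huv hu2
        rw [hG] at e2
        rw [e2]
        refine (weighted_mul_le ha0 ha1
          (measureReal_mono (separated_anti subset_rfl (Set.subset_insert _ _)))
          (measureReal_mono (separated_anti subset_rfl (Set.subset_insert _ _)))).trans ?_
        refine add_le_add (mul_le_mul_of_nonneg_left ?_ ha0)
          (mul_le_mul_of_nonneg_left (ih _ S₁ S₂ hcard) (sub_nonneg.2 ha1))
        refine (ih _ _ _ hcard).trans (measureReal_mono (separated_anti subset_rfl ?_))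
        rw [Set.insert_union_distrib]
      · have h2 : (Measure.infinitePi ν).real (separated s t G S₂ B) ≤
            (Measure.infinitePi ν).real (separated s t (G.erase e : Finset E) S₂ B) :=
          measureReal_mono (separated_anti (by simp) subset_rfl)
        refine (mul_le_mul_of_nonneg_left h2 (add_nonneg (mul_nonneg ha0 measureReal_nonneg)
          (mul_nonneg (sub_nonneg.2 ha1) measureReal_nonneg))).trans ?_
        rw [add_mul, mul_assoc, mul_assoc]
        refine add_le_add (mul_le_mul_of_nonneg_left ?_ ha0)
          (mul_le_mul_of_nonneg_left (ih _ S₁ S₂ hcard) (sub_nonneg.2 ha1))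
        refine (ih _ _ _ hcard).trans (measureReal_mono (separated_anti subset_rfl ?_))
        rw [Set.insert_union]
    · push Not at hex
      by_cases h : Disjoint S₁ B
      · refine (mul_le_of_le_one_left measureReal_nonneg measureReal_le_one).trans
          (measureReal_mono ?_)
        rintro ω ⟨A, hS, hB, hA⟩
        refine ⟨S₁ ∪ A, Set.union_subset_union_right _ hS, h.union_left hB, fun e he => ?_⟩
        have hA' := hA e he
        have h1 := (hex e he).1
        have h2 := (hex e he).2
        simp only [ClosedAt, Set.mem_union] at hA' ⊢
        tauto
      · have : separated s t G S₁ B = ∅ := by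
          ext ω
          simp only [separated, Set.mem_ofPred_eq, Set.mem_empty_iff_false, iff_false]
          rintro ⟨A, hS, hB, -⟩
          exact h (hB.mono_left hS)
        rw [this, measureReal_empty, zero_mul]
        exact measureReal_nonneg

lemma measure_separated_mul_le_union_left (G : Finset E) (S₁ S₂ B : Set V) :
    Measure.infinitePi ν (separated s t G S₁ B) * Measure.infinitePi ν (separated s t G S₂ B) ≤
    Measure.infinitePi ν (separated s t G (S₁ ∪ S₂) B) := by
  have h := measureReal_separated_mul_le (s := s) (t := t) (ν := ν) G S₁ S₂ B
  simp only [measureReal_def, ← ENNReal.toReal_mul] at h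
  exact (ENNReal.toReal_le_toReal (ENNReal.mul_ne_top (measure_ne_top _ _) (measure_ne_top _ _))
    (measure_ne_top _ _)).1 h

lemma measure_separated_mul_le_union_right (G : Finset E) (S B₁ B₂ : Set V) :
    Measure.infinitePi ν (separated s t G S B₁) * Measure.infinitePi ν (separated s t G S B₂) ≤
    Measure.infinitePi ν (separated s t G S (B₁ ∪ B₂)) := by
  simp only [separated_swap (s := s)]
  exact measure_separated_mul_le_union_left G B₁ B₂ S

end Separation

/-- The left resp. lower endpoint of `e` is the one closer to the origin. -/
def PointsOut (e : Edge) : Prop := 0 ≤ (if e.2 then e.1.2 else e.1.1)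

instance : DecidablePred PointsOut := fun e =>
  inferInstanceAs (Decidable (0 ≤ (if e.2 then e.1.2 else e.1.1)))

/-- The endpoint of `e` closer to the origin. -/
def near (e : Edge) : ℤ × ℤ := if PointsOut e then eSrc e else eDst e

/-- The endpoint of `e` farther from the origin. -/
def far (e : Edge) : ℤ × ℤ := if PointsOut e then eDst e else eSrc e

/-- The orientation in the sense of `gStep` described by `ω` in the sense of `hStep`. -/
def toG (ω : Config) : Config := fun e => if PointsOut e then ω e else !ω e

lemma closedAt_near_far {ω : Config} {A : Set (ℤ × ℤ)} {e : Edge} :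
    ClosedAt near far ω A e ↔ ClosedAt eSrc eDst (toG ω) A e := by
  by_cases h : PointsOut e <;> simp [ClosedAt, near, far, toG, h, and_comm]

lemma normSq_src_lt_iff (e : Edge) : normSq (eSrc e) < normSq (eDst e) ↔ PointsOut e := by
  obtain ⟨⟨x, y⟩, _ | _⟩ := e <;> simp [normSq, eSrc, eDst, PointsOut] <;>
    constructor <;> intro h <;> nlinarith

lemma normSq_dst_lt_iff (e : Edge) : normSq (eDst e) < normSq (eSrc e) ↔ ¬ PointsOut e := by
  obtain ⟨⟨x, y⟩, _ | _⟩ := e <;> simp [normSq, eSrc, eDst, PointsOut] <;>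
    constructor <;> intro h <;> nlinarith

lemma gStep_toG_of_hStep {ω : Config} {u v : ℤ × ℤ} (h : hStep ω u v) : gStep (toG ω) u v := by
  obtain ⟨e, ⟨rfl, rfl⟩ | ⟨rfl, rfl⟩, he⟩ := h
  · refine ⟨e, Or.inl ⟨rfl, rfl, ?_⟩⟩
    by_cases h : PointsOut e <;> simp [toG, h, he, normSq_src_lt_iff]
  · refine ⟨e, Or.inr ⟨rfl, rfl, ?_⟩⟩
    by_cases h : PointsOut e <;> simp [toG, h, he, normSq_dst_lt_iff]

lemma mem_of_gStep {η : Config} {u v : ℤ × ℤ} {A : Set (ℤ × ℤ)} (h : gStep η u v)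
    (hA : ∀ e, ClosedAt eSrc eDst η A e) (hu : u ∈ A) : v ∈ A := by
  obtain ⟨e, ⟨rfl, rfl, he⟩ | ⟨rfl, rfl, he⟩⟩ := h
  · exact (hA e).1 he hu
  · exact (hA e).2 he hu

/-- The face `f` stands for the unit square with lower left corner `f`. A step between adjacent
faces is allowed if the edge crossed is oriented from the right to the left of the step. -/
inductive DualStep (η : Config) : ℤ × ℤ → ℤ × ℤ → Prop
  | left (a b : ℤ) : η ((a, b), true) = false → DualStep η (a, b) (a - 1, b)
  | right (a b : ℤ) : η ((a, b), true) = true → DualStep η (a - 1, b) (a, b)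
  | up (a b : ℤ) : η ((a, b), false) = false → DualStep η (a, b - 1) (a, b)
  | down (a b : ℤ) : η ((a, b), false) = true → DualStep η (a, b) (a, b - 1)

/-- Steps between faces of height at least `N`. -/
def UpperDualStep (N : ℤ) (η : Config) (f g : ℤ × ℤ) : Prop :=
  DualStep η f g ∧ N ≤ f.2 ∧ N ≤ g.2

/-- The path counting function of a dual path from `f` to `g`: the signed number of times the path
passes above a vertex. -/
structure PathCount (N : ℤ) (η : Config) (f g : ℤ × ℤ) (J : ℤ × ℤ → ℤ) : Prop where
  finite : {v | N ≤ v.2 ∧ J v ≠ 0}.Finite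
  row : ∀ x, J (x, N) = (if x ≤ f.1 then 1 else 0) - (if x ≤ g.1 then 1 else 0)
  vert_true : ∀ x y, N ≤ y → η ((x, y), true) = true → J (x, y) ≤ J (x, y + 1)
  vert_false : ∀ x y, N ≤ y → η ((x, y), true) = false → J (x, y + 1) ≤ J (x, y)
  horiz_true : ∀ x y, η ((x, y), false) = true → J (x, y) - J (x + 1, y) ≤
    (if f.1 = x ∧ y ≤ f.2 then 1 else 0) - (if g.1 = x ∧ y ≤ g.2 then 1 else 0)
  horiz_false : ∀ x y, η ((x, y), false) = false →
    (if f.1 = x ∧ y ≤ f.2 then 1 else 0) - (if g.1 = x ∧ y ≤ g.2 then 1 else 0) ≤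
      J (x, y) - J (x + 1, y)

lemma finite_column (N a b : ℤ) : {v : ℤ × ℤ | N ≤ v.2 ∧ v.1 = a ∧ v.2 ≤ b}.Finite :=
  ((Set.finite_singleton a).prod (Set.finite_Icc N b)).subset fun v hv => by
    simp only [Set.mem_prod, Set.mem_singleton_iff, Set.mem_Icc]
    exact ⟨hv.2.1, hv.1, hv.2.2⟩

lemma finite_support_add_column {N : ℤ} {J : ℤ × ℤ → ℤ} (h : {v | N ≤ v.2 ∧ J v ≠ 0}.Finite)
    (a b c : ℤ) :
    {v | N ≤ v.2 ∧ J v + (if v.1 = a ∧ v.2 ≤ b then c else 0) ≠ 0}.Finite := by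
  refine (h.union (finite_column N a b)).subset ?_
  rintro v ⟨hv, hJ⟩
  by_cases hc : v.1 = a ∧ v.2 ≤ b
  · exact Or.inr ⟨hv, hc⟩
  · exact Or.inl ⟨hv, by simpa [hc] using hJ⟩

lemma exists_pathCount {N : ℤ} {η : Config} {f g : ℤ × ℤ}
    (h : Relation.ReflTransGen (UpperDualStep N η) f g) : ∃ J, PathCount N η f g J := by
  induction h with
  | refl => exact ⟨fun _ => 0, by simp, by simp, by simp, by simp, by simp, by simp⟩
  | tail _ hstep ih =>
    obtain ⟨J, hfin, hrow, hvt, hvf, hht, hhf⟩ := ih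
    obtain ⟨hstep, hN, hN'⟩ := hstep
    cases hstep with
    | left a b he =>
      refine ⟨fun v => J v + if v.1 = a ∧ v.2 ≤ b then 1 else 0, ?_, ?_, ?_, ?_, ?_, ?_⟩
      · exact finite_support_add_column hfin a b 1
      · intro x
        have := hrow x
        dsimp only at *
        split_ifs at * <;> omega
      · intro x y hy hη
        have := hvt x y hy hη
        have : ¬ (x = a ∧ y = b) := by rintro ⟨rfl, rfl⟩; simp_all
        dsimp only
        split_ifs <;> omega
      · intro x y hy hη
        have := hvf x y hy hη
        dsimp only
        split_ifs <;> omega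
      · intro x y hη
        have := hht x y hη
        dsimp only at *
        split_ifs at * <;> omega
      · intro x y hη
        have := hhf x y hη
        dsimp only at *
        split_ifs at * <;> omega
    | right a b he =>
      refine ⟨fun v => J v + if v.1 = a ∧ v.2 ≤ b then -1 else 0, ?_, ?_, ?_, ?_, ?_, ?_⟩
      · exact finite_support_add_column hfin a b (-1)
      · intro x
        have := hrow x
        dsimp only at *
        split_ifs at * <;> omega
      · intro x y hy hη
        have := hvt x y hy hη
        dsimp only
        split_ifs <;> omega
      · intro x y hy hη
        have := hvf x y hy hη
        have : ¬ (x = a ∧ y = b) := by rintro ⟨rfl, rfl⟩; simp_all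
        dsimp only
        split_ifs <;> omega
      · intro x y hη
        have := hht x y hη
        dsimp only at *
        split_ifs at * <;> omega
      · intro x y hη
        have := hhf x y hη
        dsimp only at *
        split_ifs at * <;> omega
    | up a b he =>
      refine ⟨J, hfin, hrow, hvt, hvf, ?_, ?_⟩
      · intro x y hη
        have := hht x y hη
        have : ¬ (x = a ∧ y = b) := by rintro ⟨rfl, rfl⟩; simp_all
        dsimp only at *
        split_ifs at * <;> omega
      · intro x y hη
        have := hhf x y hη
        dsimp only at *
        split_ifs at * <;> omega
    | down a b he =>
      refine ⟨J, hfin, hrow, hvt, hvf, ?_, ?_⟩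
      · intro x y hη
        have := hht x y hη
        dsimp only at *
        split_ifs at * <;> omega
      · intro x y hη
        have := hhf x y hη
        have : ¬ (x = a ∧ y = b) := by rintro ⟨rfl, rfl⟩; simp_all
        dsimp only at *
        split_ifs at * <;> omega

/-- The edges of the half plane above height `N`, without the horizontal edges at height `N`. -/
def topEdges (N : ℤ) : Set Edge := {e | if e.2 then N ≤ e.1.2 else N + 1 ≤ e.1.2}

/-- A dual path returning to its initial height from above encloses a finite closed set. -/
lemma exists_finite_closedAt {N a b : ℤ} {η : Config}
    (h : Relation.ReflTransGen (UpperDualStep N η) (a, N) (b, N)) :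
    ∃ A : Set (ℤ × ℤ), A.Finite ∧ (∀ v ∈ A, N ≤ v.2) ∧ (∀ x, (x, N) ∈ A ↔ b < x ∧ x ≤ a) ∧
      ∀ e ∈ topEdges N, ClosedAt eSrc eDst η A e := by
  obtain ⟨J, hfin, hrow, hvt, hvf, hht, hhf⟩ := exists_pathCount h
  refine ⟨{v | N ≤ v.2 ∧ 1 ≤ J v}, hfin.subset fun v hv => ⟨hv.1, ?_⟩, fun v hv => hv.1, ?_, ?_⟩
  · have := hv.2
    omega
  · intro x
    have := hrow x
    simp only [Set.mem_ofPred_eq, le_refl, true_and]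
    dsimp only at *
    split_ifs at * <;> omega
  · rintro ⟨⟨x, y⟩, _ | _⟩ he
    · simp only [topEdges, Set.mem_ofPred_eq, Bool.false_eq_true, if_false] at he
      simp only [ClosedAt, eSrc, eDst, Set.mem_ofPred_eq, Bool.false_eq_true, if_false]
      constructor
      · intro hη hv
        have := hht x y hη
        dsimp only at *
        split_ifs at * <;> omega
      · intro hη hv
        have := hhf x y hη
        dsimp only at *
        split_ifs at * <;> omega
    · simp only [topEdges, Set.mem_ofPred_eq, if_true] at he
      simp only [ClosedAt, eSrc, eDst, Set.mem_ofPred_eq, if_true]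
      constructor
      · intro hη hv
        have := hvt x y he hη
        omega
      · intro hη hv
        have := hvf x y he hη
        omega

/-- Some finite vertex set containing `S` and avoiding `B` is not left through any edge of `G`. -/
def finSep (G : Set Edge) (S B : Set (ℤ × ℤ)) : Set Config :=
  {ω | ∃ A : Set (ℤ × ℤ), A.Finite ∧ S ⊆ A ∧ Disjoint A B ∧ ∀ e ∈ G, ClosedAt near far ω A e}

/-- The box of vertices with coordinates at most `M` in absolute value. -/
def box (M : ℕ) : Set (ℤ × ℤ) := {v | v.1.natAbs ≤ M ∧ v.2.natAbs ≤ M}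

lemma box_mono {M M' : ℕ} (h : M ≤ M') : box M ⊆ box M' := fun v hv => by
  have := hv.1
  have := hv.2
  constructor <;> omega

lemma finite_box (M : ℕ) : (box M).Finite :=
  ((Set.finite_Icc (-(M : ℤ)) M).prod (Set.finite_Icc (-(M : ℤ)) M)).subset fun v hv => by
    have := hv.1
    have := hv.2
    simp only [Set.mem_prod, Set.mem_Icc]
    omega

lemma exists_subset_box {A : Set (ℤ × ℤ)} (hA : A.Finite) : ∃ M, A ⊆ box M := by
  induction A, hA using Set.Finite.induction_on with
  | empty => exact ⟨0, Set.empty_subset _⟩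
  | @insert a s _ _ ih =>
    obtain ⟨M, hM⟩ := ih
    refine ⟨M + a.1.natAbs + a.2.natAbs, Set.insert_subset ?_ (hM.trans (box_mono (by omega)))⟩
    constructor <;> omega

lemma finite_edges_src_mem {A : Set (ℤ × ℤ)} (hA : A.Finite) : {e : Edge | e.1 ∈ A}.Finite :=
  (hA.prod (Set.finite_univ (α := Bool))).subset fun e he => by simpa using he

/-- The edges of `G` close to the box of size `M`. -/
noncomputable def boxEdges (G : Set Edge) (M : ℕ) : Finset Edge :=
  ((finite_edges_src_mem (finite_box (M + 1))).inter_of_left G).toFinset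

lemma mem_boxEdges {G : Set Edge} {M : ℕ} {e : Edge} :
    e ∈ boxEdges G M ↔ e.1 ∈ box (M + 1) ∧ e ∈ G := by
  simp [boxEdges]

lemma src_mem_box_succ {M : ℕ} {e : Edge} (h : near e ∈ box M ∨ far e ∈ box M) :
    e.1 ∈ box (M + 1) := by
  have h' : eSrc e ∈ box M ∨ eDst e ∈ box M := by
    unfold near far at h
    split_ifs at h <;> tauto
  obtain ⟨⟨x, y⟩, _ | _⟩ := e <;>
    simp only [eSrc, eDst, box, Set.mem_ofPred_eq, if_true, Bool.false_eq_true, if_false] at * <;>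
    constructor <;> omega

lemma mem_separated_boxEdges {G : Set Edge} {S B : Set (ℤ × ℤ)} {M : ℕ} {ω : Config} :
    ω ∈ separated near far (boxEdges G M) S (B ∪ (box M)ᶜ) ↔
      ∃ A ⊆ box M, S ⊆ A ∧ Disjoint A B ∧ ∀ e ∈ G, ClosedAt near far ω A e := by
  constructor
  · rintro ⟨A, hS, hB, hA⟩
    rw [Set.disjoint_union_right, Set.disjoint_compl_right_iff_subset] at hB
    refine ⟨A, hB.2, hS, hB.1, fun e he => ?_⟩
    by_cases h : near e ∈ A ∨ far e ∈ A
    · exact hA e (mem_boxEdges.2 ⟨src_mem_box_succ (h.imp (@hB.2 _) (@hB.2 _)), he⟩)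
    · rw [not_or] at h
      exact ⟨fun _ h' => absurd h' h.1, fun _ h' => absurd h' h.2⟩
  · rintro ⟨A, hM, hS, hB, hA⟩
    refine ⟨A, hS, ?_, fun e he => hA e (mem_boxEdges.1 he).2⟩
    rw [Set.disjoint_union_right, Set.disjoint_compl_right_iff_subset]
    exact ⟨hB, hM⟩

lemma finSep_eq_iUnion (G : Set Edge) (S B : Set (ℤ × ℤ)) :
    finSep G S B = ⋃ M, separated near far (boxEdges G M) S (B ∪ (box M)ᶜ) := by
  ext ω
  simp only [Set.mem_iUnion, mem_separated_boxEdges]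
  constructor
  · rintro ⟨A, hfin, h⟩
    obtain ⟨M, hM⟩ := exists_subset_box hfin
    exact ⟨M, A, hM, h⟩
  · rintro ⟨M, A, hM, h⟩
    exact ⟨A, (finite_box M).subset hM, h⟩

lemma monotone_separated_boxEdges (G : Set Edge) (S B : Set (ℤ × ℤ)) :
    Monotone fun M => separated near far (boxEdges G M) S (B ∪ (box M)ᶜ) := by
  intro M M' h ω hω
  obtain ⟨A, hM, h'⟩ := mem_separated_boxEdges.1 hω
  exact mem_separated_boxEdges.2 ⟨A, hM.trans (box_mono h), h'⟩

lemma measurableSet_finSep (G : Set Edge) (S B : Set (ℤ × ℤ)) : MeasurableSet (finSep G S B) := by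
  rw [finSep_eq_iUnion]
  exact .iUnion fun M => (determinedBy_separated _ _ _).measurableSet

lemma determinedBy_finSep (G : Set Edge) (S B : Set (ℤ × ℤ)) : DeterminedBy (finSep G S B) G := by
  rintro ω ω' hω ⟨A, hfin, hS, hB, hA⟩
  exact ⟨A, hfin, hS, hB, fun e he => (hA e he).congr (hω e he)⟩

section Measure

variable {ν : Edge → Measure Bool}

lemma tendsto_measure_separated_boxEdges (G : Set Edge) (S B : Set (ℤ × ℤ)) :
    Filter.Tendsto (fun M => Measure.infinitePi ν
      (separated near far (boxEdges G M) S (B ∪ (box M)ᶜ))) Filter.atTop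
      (nhds (Measure.infinitePi ν (finSep G S B))) := by
  rw [finSep_eq_iUnion]
  exact tendsto_measure_iUnion_atTop (monotone_separated_boxEdges G S B)

variable [∀ i, IsProbabilityMeasure (ν i)]

lemma measure_finSep_mul_le_union_left (G : Set Edge) (S₁ S₂ B : Set (ℤ × ℤ)) :
    Measure.infinitePi ν (finSep G S₁ B) * Measure.infinitePi ν (finSep G S₂ B) ≤
      Measure.infinitePi ν (finSep G (S₁ ∪ S₂) B) :=
  le_of_tendsto_of_tendsto' (ENNReal.Tendsto.mul (tendsto_measure_separated_boxEdges G S₁ B)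
      (Or.inr (measure_ne_top _ _)) (tendsto_measure_separated_boxEdges G S₂ B)
      (Or.inr (measure_ne_top _ _)))
    (tendsto_measure_separated_boxEdges G (S₁ ∪ S₂) B)
    fun _ => measure_separated_mul_le_union_left _ _ _ _

lemma measure_finSep_mul_le_union_right (G : Set Edge) (S B₁ B₂ : Set (ℤ × ℤ)) :
    Measure.infinitePi ν (finSep G S B₁) * Measure.infinitePi ν (finSep G S B₂) ≤
      Measure.infinitePi ν (finSep G S (B₁ ∪ B₂)) := by
  refine le_of_tendsto_of_tendsto' (ENNReal.Tendsto.mul (tendsto_measure_separated_boxEdges G S B₁)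
      (Or.inr (measure_ne_top _ _)) (tendsto_measure_separated_boxEdges G S B₂)
      (Or.inr (measure_ne_top _ _)))
    (tendsto_measure_separated_boxEdges G S (B₁ ∪ B₂)) fun M => ?_
  rw [Set.union_union_distrib_right]
  exact measure_separated_mul_le_union_right _ _ _ _

end Measure

lemma measure_finSep_le_of_symmetry {p : ℝ} (hp0 : 0 ≤ p) (hp1 : p ≤ 1) {τ : Edge → Edge}
    {ρ : ℤ × ℤ → ℤ × ℤ} (hτ : Function.Involutive τ) (hρ : Function.Involutive ρ)
    (hnear : ∀ e, near (τ e) = ρ (near e)) (hfar : ∀ e, far (τ e) = ρ (far e))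
    (G : Set Edge) (S B : Set (ℤ × ℤ)) :
    Measure.infinitePi (fun _ : Edge => bern p) (finSep G S B) ≤
      Measure.infinitePi (fun _ : Edge => bern p) (finSep (τ ⁻¹' G) (ρ ⁻¹' S) (ρ ⁻¹' B)) := by
  rw [← measure_preimage_reindex hp0 hp1 hτ.injective (measurableSet_finSep G S B)]
  refine measure_mono ?_
  rintro ω ⟨A, hfin, hS, hB, hA⟩
  refine ⟨ρ ⁻¹' A, hfin.preimage hρ.injective.injOn, Set.preimage_mono hS, hB.preimage ρ,
    fun e he => ?_⟩
  have h := hA (τ e) he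
  simpa [ClosedAt, hnear, hfar, hτ e] using h

/-- Reflection of edges along the vertical axis. -/
def reflX (e : Edge) : Edge := if e.2 then ((-e.1.1, e.1.2), true) else ((-e.1.1 - 1, e.1.2), false)

/-- Reflection of edges along the horizontal axis. -/
def reflY (e : Edge) : Edge := if e.2 then ((e.1.1, -e.1.2 - 1), true) else ((e.1.1, -e.1.2), false)

lemma reflX_involutive : Function.Involutive reflX := by
  rintro ⟨⟨x, y⟩, _ | _⟩ <;> simp [reflX]

lemma reflY_involutive : Function.Involutive reflY := by
  rintro ⟨⟨x, y⟩, _ | _⟩ <;> simp [reflY]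

lemma near_reflX (e : Edge) : near (reflX e) = (-(near e).1, (near e).2) := by
  obtain ⟨⟨x, y⟩, _ | _⟩ := e <;> simp only [near, reflX, PointsOut, eSrc, eDst, if_true,
    Bool.false_eq_true, if_false] <;> split_ifs <;> simp <;> omega

lemma far_reflX (e : Edge) : far (reflX e) = (-(far e).1, (far e).2) := by
  obtain ⟨⟨x, y⟩, _ | _⟩ := e <;> simp only [far, reflX, PointsOut, eSrc, eDst, if_true,
    Bool.false_eq_true, if_false] <;> split_ifs <;> simp <;> omega

lemma near_reflY (e : Edge) : near (reflY e) = ((near e).1, -(near e).2) := by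
  obtain ⟨⟨x, y⟩, _ | _⟩ := e <;> simp only [near, reflY, PointsOut, eSrc, eDst, if_true,
    Bool.false_eq_true, if_false] <;> split_ifs <;> simp <;> omega

lemma far_reflY (e : Edge) : far (reflY e) = ((far e).1, -(far e).2) := by
  obtain ⟨⟨x, y⟩, _ | _⟩ := e <;> simp only [far, reflY, PointsOut, eSrc, eDst, if_true,
    Bool.false_eq_true, if_false] <;> split_ifs <;> simp <;> omega

lemma measurableSet_reflTransGen {Ω V : Type*} [MeasurableSpace Ω] [Countable V]
    {r : Ω → V → V → Prop} (hr : ∀ u v, MeasurableSet {ω | r ω u v}) (u v : V) :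
    MeasurableSet {ω | Relation.ReflTransGen (r ω) u v} := by
  let reach : ℕ → V → Set Ω := fun n =>
    Nat.rec (fun v => {_ω | u = v}) (fun _ X v => ⋃ w, X w ∩ {ω | r ω w v}) n
  have hreach : ∀ n v, MeasurableSet (reach n v) := by
    intro n
    induction n with
    | zero => exact fun v => .const _
    | succ n ih => exact fun v => .iUnion fun w => (ih w).inter (hr w v)
  have heq : {ω | Relation.ReflTransGen (r ω) u v} = ⋃ n, reach n v := by
    ext ω
    rw [Set.mem_iUnion]
    constructor
    · intro h
      induction h with
      | refl => exact ⟨0, rfl⟩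
      | tail _ h ih =>
        obtain ⟨n, hn⟩ := ih
        exact ⟨n + 1, Set.mem_iUnion.2 ⟨_, hn, h⟩⟩
    · rintro ⟨n, hn⟩
      induction n generalizing v with
      | zero => exact (show u = v from hn) ▸ .refl
      | succ n ih =>
        obtain ⟨w, hw, h⟩ := Set.mem_iUnion.1 hn
        exact .tail (ih w hw) h
  rw [heq]
  exact .iUnion fun n => hreach n v

lemma measurableSet_apply_eq {I : Type*} (e : I) (b : Bool) :
    MeasurableSet {ω : I → Bool | ω e = b} :=
  measurableSet_eq_fun (measurable_pi_apply e) measurable_const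

lemma measurableSet_gStep (u v : ℤ × ℤ) : MeasurableSet {η | gStep η u v} := by
  simp only [gStep, Set.ofPred_exists, Set.ofPred_or, Set.ofPred_and]
  exact .iUnion fun e => .union (.inter (.const _) (.inter (.const _) (measurableSet_apply_eq e _)))
    (.inter (.const _) (.inter (.const _) (measurableSet_apply_eq e _)))

/-- The vertical half strip of width `d`. -/
def strip (d : ℕ) : Set (ℤ × ℤ) := {v | 0 ≤ v.1 ∧ v.1 ≤ d ∧ 0 ≤ v.2}

/-- Steps inside the strip of width `d`. -/
def StripStep (d : ℕ) (η : Config) (u v : ℤ × ℤ) : Prop := gStep η u v ∧ u ∈ strip d ∧ v ∈ strip d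

/-- There is a path in the strip of width `d` from the origin which leaves the strip to the right
at height `m`. -/
def exitAt (d m : ℕ) : Set Config :=
  {η | Relation.ReflTransGen (StripStep d η) (0, 0) (d, m) ∧ η ((d, m), false) = true}

lemma measurableSet_exitAt (d m : ℕ) : MeasurableSet (exitAt d m) := by
  refine .inter (measurableSet_reflTransGen (fun u v => ?_) _ _) (measurableSet_apply_eq _ _)
  exact (measurableSet_gStep u v).inter (.const _)

lemma determinedBy_exitAt (d m : ℕ) : DeterminedBy (exitAt d m) {e | e.1 ∈ strip d} := by
  rintro η η' h ⟨hpath, hexit⟩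
  refine ⟨Relation.ReflTransGen.mono ?_ _ _ hpath, (h _ ?_).symm.trans hexit⟩
  · rintro u v ⟨⟨e, ⟨hu, hv, he⟩ | ⟨hv, hu, he⟩⟩, hus, hvs⟩
    · refine ⟨⟨e, Or.inl ⟨hu, hv, (h e ?_).symm.trans he⟩⟩, hus, hvs⟩
      exact show eSrc e ∈ strip d from hu ▸ hus
    · refine ⟨⟨e, Or.inr ⟨hv, hu, (h e ?_).symm.trans he⟩⟩, hus, hvs⟩
      exact show eSrc e ∈ strip d from hv ▸ hvs
  · constructor <;> simp

lemma measure_forall_eq_false {I : Type*} {p : ℝ} (hp0 : 0 ≤ p) (hp1 : p ≤ 1) (F : Finset I) :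
    Measure.infinitePi (fun _ : I => bern p) {ω | ∀ e ∈ F, ω e = false} =
      ENNReal.ofReal (1 - p) ^ F.card := by
  have := isProbabilityMeasure_bern hp0 hp1
  have h := Measure.infinitePi_pi (fun _ : I => bern p) (s := F) (t := fun _ => {false})
    fun _ _ => .of_discrete
  have hfalse : bern p {false} = ENNReal.ofReal (1 - p) := by
    classical
    simp [bern_apply]
  rw [Finset.prod_const, hfalse] at h
  exact h

lemma determinedBy_forall_eq_false {I : Type*} (F : Finset I) :
    DeterminedBy {ω : I → Bool | ∀ e ∈ F, ω e = false} F :=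
  fun _ _ h hω e he => (h e he).symm.trans (hω e he)

/-- The vertical edges across the strip between heights `L` and `L + 1`. -/
noncomputable def level (d L : ℕ) : Finset Edge :=
  (Finset.Icc (0 : ℤ) d ×ˢ {(L : ℤ)}) ×ˢ {true}

lemma mem_level {d L : ℕ} {e : Edge} :
    e ∈ level d L ↔ (0 ≤ e.1.1 ∧ e.1.1 ≤ d) ∧ e.1.2 = L ∧ e.2 = true := by
  simp only [level, Finset.mem_product, Finset.mem_Icc, Finset.mem_singleton, and_assoc]

lemma card_level (d L : ℕ) : (level d L).card = d + 1 := by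
  simp [level]

lemma measure_exists_level {q : ℝ} (hq0 : 0 ≤ q) (hq1 : q < 1) (d : ℕ) :
    Measure.infinitePi (fun _ : Edge => bern q) (⋃ L, {η | ∀ e ∈ level d L, η e = false}) = 1 := by
  have := isProbabilityMeasure_bern hq0 hq1.le
  refine measure_iUnion_eq_one (S := fun L => level d L) (c := ENNReal.ofReal (1 - q) ^ (d + 1))
    ?_ (fun L => (determinedBy_forall_eq_false _).measurableSet)
    (fun L => determinedBy_forall_eq_false _) ?_ fun L => ?_
  · intro L L' hne
    refine Set.disjoint_left.2 fun e he he' => hne ?_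
    have h := (mem_level.1 he).2.1
    have h' := (mem_level.1 he').2.1
    omega
  · exact pow_ne_zero _ (by simpa using hq1)
  · rw [measure_forall_eq_false hq0 hq1.le, card_level]

lemma eq_right_of_gStep {η : Config} {u v : ℤ × ℤ} (h : gStep η u v) (huv : u.1 < v.1) :
    v = (u.1 + 1, u.2) ∧ η (u, false) = true := by
  obtain ⟨⟨⟨x, y⟩, _ | _⟩, ⟨rfl, rfl, he⟩ | ⟨rfl, rfl, he⟩⟩ := h <;>
    simp_all [eSrc, eDst]

lemma eq_up_of_gStep {η : Config} {u v : ℤ × ℤ} (h : gStep η u v) (huv : u.2 < v.2) :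
    v = (u.1, u.2 + 1) ∧ η (u, true) = true := by
  obtain ⟨⟨⟨x, y⟩, _ | _⟩, ⟨rfl, rfl, he⟩ | ⟨rfl, rfl, he⟩⟩ := h <;>
    simp_all [eSrc, eDst]

lemma mem_exitAt_of_percolates {η : Config} {d L : ℕ} (h : percolates (gStep η) NEquad)
    (hL : ∀ e ∈ level d L, η e = false) : ∃ m, η ∈ exitAt d m := by
  obtain ⟨γ, h0, hinj, hstep, hNE⟩ := h
  have hex : ∃ n, (d : ℤ) < (γ n).1 := by
    by_contra! hle
    have hheight : ∀ n, (γ n).2 ≤ L := by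
      intro n
      induction n with
      | zero => simp [h0]
      | succ n ih =>
        by_contra! hlt
        obtain ⟨hv, he⟩ := eq_up_of_gStep (hstep n) (ih.trans_lt hlt)
        rw [hv] at hlt
        have := hL (γ n, true) (mem_level.2 ⟨⟨(hNE n).1, hle n⟩, by dsimp only at *; omega, rfl⟩)
        simp_all
    refine Set.infinite_range_of_injective hinj
      (((Set.finite_Icc (0 : ℤ) d).prod (Set.finite_Icc (0 : ℤ) L)).subset ?_)
    rintro _ ⟨n, rfl⟩
    exact ⟨⟨(hNE n).1, hle n⟩, ⟨(hNE n).2, hheight n⟩⟩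
  classical
  obtain ⟨n, hn⟩ : ∃ n, Nat.find hex = n + 1 := by
    refine Nat.exists_eq_succ_of_ne_zero fun h => ?_
    have := Nat.find_spec hex
    rw [h, h0] at this
    simp only at this
    omega
  have hle : ∀ k ≤ n, γ k ∈ strip d := fun k hk =>
    ⟨(hNE k).1, not_lt.1 (Nat.find_min hex (by omega)), (hNE k).2⟩
  have hpath : ∀ k ≤ n, Relation.ReflTransGen (StripStep d η) (0, 0) (γ k) := by
    intro k
    induction k with
    | zero => exact fun _ => h0 ▸ .refl
    | succ k ih => exact fun hk => .tail (ih (by omega)) ⟨hstep k, hle k (by omega), hle _ hk⟩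
  have hout := Nat.find_spec hex
  rw [hn] at hout
  obtain ⟨hv, he⟩ := eq_right_of_gStep (hstep n) ((hle n le_rfl).2.1.trans_lt hout)
  have hγ : γ n = ((d : ℤ), (((γ n).2.toNat : ℕ) : ℤ)) := by
    have h1 := (hle n le_rfl).2.1
    rw [hv] at hout
    refine Prod.ext ?_ (Int.toNat_of_nonneg (hNE n).2).symm
    dsimp only at *
    omega
  refine ⟨(γ n).2.toNat, ?_, ?_⟩
  · rw [← hγ]
    exact hpath n le_rfl
  · rw [← hγ]
    exact he

/-- Percolation in the quadrant forces the path to leave each strip. -/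
lemma thetaNE_le_measure_exitAt {q : ℝ} (hq0 : 0 ≤ q) (hq1 : q < 1) (d : ℕ) :
    thetaNE q ≤ Measure.infinitePi (fun _ : Edge => bern q) (⋃ m, exitAt d m) := by
  have := isProbabilityMeasure_bern hq0 hq1.le
  rw [thetaNE, mu, bernoulliProduct_eq hq0 hq1.le]
  have hae : ∀ᵐ η ∂Measure.infinitePi (fun _ : Edge => bern q),
      η ∈ ⋃ L, {η : Config | ∀ e ∈ level d L, η e = false} := by
    refine (mem_ae_iff_prob_eq_one ?_).2 (measure_exists_level hq0 hq1 d)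
    exact .iUnion fun L => (determinedBy_forall_eq_false _).measurableSet
  refine measure_mono_ae ?_
  filter_upwards [hae] with η hη h
  obtain ⟨L, hL⟩ := Set.mem_iUnion.1 hη
  exact Set.mem_iUnion.2 (mem_exitAt_of_percolates h hL)

/-- The edge crossed by the dual of `e` when the strip is turned into faces `(n - x, N + y)`. -/
def rightEdge (n N : ℕ) (e : Edge) : Edge :=
  if e.2 then ((n - e.1.1, N + e.1.2 + 1), false) else ((n - e.1.1, N + e.1.2), true)

/-- The edge crossed by the dual of `e` when the strip is turned into faces
`(-1 - y, N + m - x)`. -/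
def leftEdge (N m : ℕ) (e : Edge) : Edge := ((-1 - e.1.2, N + m - e.1.1), e.2)

lemma rightEdge_injective (n N : ℕ) : Function.Injective (rightEdge n N) := by
  rintro ⟨⟨x, y⟩, _ | _⟩ ⟨⟨x', y'⟩, _ | _⟩ h <;> simp_all [rightEdge]

lemma leftEdge_injective (N m : ℕ) : Function.Injective (leftEdge N m) := by
  rintro ⟨⟨x, y⟩, b⟩ ⟨⟨x', y'⟩, b'⟩ h
  simp_all [leftEdge]

lemma upperDualStep_right {n N : ℕ} {ω : Config} {u v : ℤ × ℤ}
    (h : StripStep n (fun e => !ω (rightEdge n N e)) u v) :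
    UpperDualStep N (toG ω) (n - u.1, N + u.2) (n - v.1, N + v.2) := by
  obtain ⟨h, ⟨hu1, hu2, hu3⟩, hv1, hv2, hv3⟩ := h
  refine ⟨?_, by dsimp only; omega, by dsimp only; omega⟩
  obtain ⟨⟨⟨x, y⟩, _ | _⟩, ⟨rfl, rfl, he⟩ | ⟨rfl, rfl, he⟩⟩ := h <;>
    simp only [eSrc, eDst, rightEdge, if_true, Bool.false_eq_true, if_false, Bool.not_eq_eq_eq_not,
      Bool.not_true, Bool.not_false] at *
  · have := DualStep.left (η := toG ω) (n - x) (N + y) (by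
      rw [toG, if_pos (show PointsOut _ by simp [PointsOut]; omega), he])
    convert this using 2; ring
  · have := DualStep.right (η := toG ω) (n - x) (N + y) (by
      rw [toG, if_pos (show PointsOut _ by simp [PointsOut]; omega), he])
    convert this using 2; ring
  · have := DualStep.up (η := toG ω) (n - x) (N + y + 1) (by
      rw [toG, if_pos (show PointsOut _ by simp [PointsOut]; omega), he])
    convert this using 2 <;> ring
  · have := DualStep.down (η := toG ω) (n - x) (N + y + 1) (by
      rw [toG, if_pos (show PointsOut _ by simp [PointsOut]; omega), he])
    convert this using 2 <;> ring

lemma upperDualStep_left {N m : ℕ} {ω : Config} {u v : ℤ × ℤ}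
    (h : StripStep m (fun e => !ω (leftEdge N m e)) u v) :
    UpperDualStep N (toG ω) (-1 - u.2, N + m - u.1) (-1 - v.2, N + m - v.1) := by
  obtain ⟨h, ⟨hu1, hu2, hu3⟩, hv1, hv2, hv3⟩ := h
  refine ⟨?_, by dsimp only; omega, by dsimp only; omega⟩
  obtain ⟨⟨⟨x, y⟩, _ | _⟩, ⟨rfl, rfl, he⟩ | ⟨rfl, rfl, he⟩⟩ := h <;>
    simp only [eSrc, eDst, leftEdge, if_true, Bool.false_eq_true, if_false, Bool.not_eq_eq_eq_not,
      Bool.not_true, Bool.not_false] at *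
  · have := DualStep.down (η := toG ω) (-1 - y) (N + m - x) (by
      rw [toG, if_neg (show ¬ PointsOut _ by simp [PointsOut]; omega), he, Bool.not_false])
    convert this using 2; ring
  · have := DualStep.up (η := toG ω) (-1 - y) (N + m - x) (by
      rw [toG, if_neg (show ¬ PointsOut _ by simp [PointsOut]; omega), he, Bool.not_true])
    convert this using 2; ring
  · have := DualStep.left (η := toG ω) (-1 - y) (N + m - x) (by
      rw [toG, if_pos (show PointsOut _ by simp [PointsOut]; omega), he])
    convert this using 2; ring
  · have := DualStep.right (η := toG ω) (-1 - y) (N + m - x) (by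
      rw [toG, if_pos (show PointsOut _ by simp [PointsOut]; omega), he])
    convert this using 2; ring

/-- An arc from the right half axis at height `N` to the left one, through the upper half plane. -/
lemma upperDualPath {n N m m' : ℕ} {ω : Config}
    (h : (fun e => !ω (rightEdge n N e)) ∈ exitAt n m)
    (h' : (fun e => !ω (leftEdge N m e)) ∈ exitAt m m') :
    Relation.ReflTransGen (UpperDualStep N (toG ω)) ((n : ℤ), (N : ℤ)) (-1 - (m' : ℤ), (N : ℤ)) := by
  have h1 : Relation.ReflTransGen (UpperDualStep N (toG ω)) ((n : ℤ) - 0, (N : ℤ) + 0)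
      ((n : ℤ) - n, (N : ℤ) + m) := Relation.ReflTransGen.lift
    (p := UpperDualStep N (toG ω)) (fun v : ℤ × ℤ => ((n : ℤ) - v.1, (N : ℤ) + v.2))
    (fun _ _ => upperDualStep_right) _ _ h.1
  have h2 : Relation.ReflTransGen (UpperDualStep N (toG ω)) (-1 - 0, (N : ℤ) + m - 0)
      (-1 - (m' : ℤ), (N : ℤ) + m - m) := Relation.ReflTransGen.lift
    (p := UpperDualStep N (toG ω)) (fun v : ℤ × ℤ => (-1 - v.2, (N : ℤ) + m - v.1))
    (fun _ _ => upperDualStep_left) _ _ h'.1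
  have he : ω ((0, N + m), true) = false := by
    have := h.2
    simpa [rightEdge] using this
  have hmid : UpperDualStep N (toG ω) (0, N + m) (0 - 1, N + m) := by
    refine ⟨.left 0 (N + m) ?_, by simp, by simp⟩
    rw [toG, if_pos (show PointsOut _ by simp [PointsOut]; omega), he]
  simp only [sub_zero, add_zero, sub_self, zero_sub, add_sub_cancel_right] at h1 h2 hmid
  exact (h1.tail hmid).trans h2

section Measure

variable {p : ℝ}

/-- Probability that there is an arc above height `N` starting above `n`. -/
lemma thetaNE_sq_le_measure_arc (hp0 : 0 < p) (hp1 : p ≤ 1) (n N : ℕ) :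
    thetaNE (1 - p) * thetaNE (1 - p) ≤ Measure.infinitePi (fun _ : Edge => bern p)
      {ω | ∃ k : ℕ, Relation.ReflTransGen (UpperDualStep N (toG ω)) (n, N) (-1 - k, N)} := by
  have := isProbabilityMeasure_bern hp0.le hp1
  have hmeas : ∀ d, MeasurableSet (⋃ m, exitAt d m) := fun d => .iUnion (measurableSet_exitAt d)
  have hdet : ∀ d, DeterminedBy (⋃ m, exitAt d m) {e | e.1 ∈ strip d} :=
    fun d => .iUnion (determinedBy_exitAt d)
  have hpre : ∀ σ : Edge → Edge, Measurable fun (ω : Config) e => !ω (σ e) := fun σ =>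
    measurable_pi_iff.2 fun e => (Measurable.of_discrete (f := not)).comp (measurable_pi_apply _)
  have hbound : ∀ d {σ : Edge → Edge}, Function.Injective σ → thetaNE (1 - p) ≤
      Measure.infinitePi (fun _ : Edge => bern p)
        ((fun (ω : Config) e => !ω (σ e)) ⁻¹' ⋃ m, exitAt d m) := fun d σ hσ => by
    rw [measure_preimage_reindex_not hp0.le hp1 hσ (hmeas d)]
    exact thetaNE_le_measure_exitAt (by linarith) (by linarith) d
  calc thetaNE (1 - p) * thetaNE (1 - p)
      ≤ Measure.infinitePi (fun _ : Edge => bern p)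
          (⋃ m, (fun (ω : Config) e => !ω (rightEdge n N e)) ⁻¹' exitAt n m) *
          thetaNE (1 - p) := by
        gcongr
        rw [← Set.preimage_iUnion]
        exact hbound n (rightEdge_injective n N)
    _ ≤ Measure.infinitePi (fun _ : Edge => bern p)
          (⋃ m, (fun (ω : Config) e => !ω (rightEdge n N e)) ⁻¹' exitAt n m ∩
            (fun (ω : Config) e => !ω (leftEdge N m e)) ⁻¹' ⋃ m', exitAt m m') := by
        refine mul_le_measure_iUnion_inter (S := {e | 0 ≤ e.1.1}) (T := {e | e.1.1 ≤ -1})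
          ?_ (fun m => hpre _ (measurableSet_exitAt n m)) (fun m ω ω' h hω => ?_)
          (fun m => hpre _ (hmeas m)) (fun m ω ω' h hω => ?_)
          fun m => hbound m (leftEdge_injective N m)
        · refine Set.disjoint_left.2 fun e he he' => ?_
          simp only [Set.mem_ofPred_eq] at he he'
          omega
        · refine determinedBy_exitAt n m _ _ (fun e he => congrArg _ (h _ ?_)) hω
          obtain ⟨⟨x, y⟩, _ | _⟩ := e <;> simp [rightEdge, strip] at * <;> omega
        · refine hdet m _ _ (fun e he => congrArg _ (h _ ?_)) hω
          obtain ⟨⟨x, y⟩, _ | _⟩ := e <;> simp [leftEdge, strip] at * <;> omega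
    _ ≤ _ := by
        refine measure_mono (Set.iUnion_subset fun m => ?_)
        rintro ω ⟨h, h'⟩
        obtain ⟨k, hk⟩ := Set.mem_iUnion.1 h'
        exact ⟨k, upperDualPath h hk⟩

end Measure

/-- A horizontal segment of vertices. -/
def segment (y a b : ℤ) : Set (ℤ × ℤ) := {v | v.2 = y ∧ a ≤ v.1 ∧ v.1 ≤ b}

/-- The vertices below height `y`, and those at height `y` to the right of `b`. -/
def belowRight (y b : ℤ) : Set (ℤ × ℤ) := {v | v.2 < y ∨ v.2 = y ∧ b < v.1}

/-- The vertices below height `y`, and those at height `y` to the left of `a`. -/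
def belowLeft (y a : ℤ) : Set (ℤ × ℤ) := {v | v.2 < y ∨ v.2 = y ∧ v.1 < a}

/-- The segment of length `2n` at height `N` is cut off from infinity above height `N`. -/
def topClosed (N n : ℕ) : Set Config :=
  finSep (topEdges N) (segment N (-n) n) (belowRight N n ∪ belowLeft N (-n))

/-- The reflection of `topClosed` along the horizontal axis. -/
def bottomClosed (N n : ℕ) : Set Config :=
  finSep (reflY ⁻¹' topEdges N) ((fun v : ℤ × ℤ => (v.1, -v.2)) ⁻¹' segment N (-n) n)
    ((fun v : ℤ × ℤ => (v.1, -v.2)) ⁻¹' (belowRight N n ∪ belowLeft N (-n)))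

section Measure

variable {p : ℝ}

lemma measure_finSep_top_le_reflect (hp0 : 0 ≤ p) (hp1 : p ≤ 1) (N : ℤ) {S S' B B' : Set (ℤ × ℤ)}
    (hS : ∀ x y, (x, y) ∈ S' ↔ (-x, y) ∈ S) (hB : ∀ x y, (x, y) ∈ B' ↔ (-x, y) ∈ B) :
    Measure.infinitePi (fun _ : Edge => bern p) (finSep (topEdges N) S B) ≤
      Measure.infinitePi (fun _ : Edge => bern p) (finSep (topEdges N) S' B') := by
  have h := measure_finSep_le_of_symmetry hp0 hp1 reflX_involutive
    (ρ := fun v => (-v.1, v.2)) (fun v => by simp) near_reflX far_reflX (topEdges N) S B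
  have hE : reflX ⁻¹' topEdges N = topEdges N := by
    ext ⟨⟨x, y⟩, _ | _⟩ <;> simp [topEdges, reflX]
  have hS' : (fun v : ℤ × ℤ => (-v.1, v.2)) ⁻¹' S = S' := by
    ext ⟨x, y⟩
    exact (hS x y).symm
  have hB' : (fun v : ℤ × ℤ => (-v.1, v.2)) ⁻¹' B = B' := by
    ext ⟨x, y⟩
    exact (hB x y).symm
  rwa [hE, hS', hB'] at h

lemma measure_topClosed_ge (hp0 : 0 < p) (hp1 : p ≤ 1) (N n : ℕ) :
    (thetaNE (1 - p) * thetaNE (1 - p) / 2) * (thetaNE (1 - p) * thetaNE (1 - p) / 2) ≤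
      Measure.infinitePi (fun _ : Edge => bern p) (topClosed N n) := by
  have := isProbabilityMeasure_bern hp0.le hp1
  set P := Measure.infinitePi (fun _ : Edge => bern p)
  set short := finSep (topEdges N) (segment N 0 n) (belowRight N n ∪ belowLeft N (-n))
  set long := finSep (topEdges N) (segment N (-n) n) (belowRight N n)
  have hshort : P short * P short ≤ P (topClosed N n) := by
    calc P short * P short
        ≤ P short * P (finSep (topEdges N) (segment N (-n) 0)
            (belowRight N n ∪ belowLeft N (-n))) := by
          refine mul_le_mul_right ?_ _
          refine measure_finSep_top_le_reflect hp0.le hp1 N ?_ ?_ <;> intro x y <;>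
            simp only [segment, belowRight, belowLeft, Set.mem_union, Set.mem_ofPred_eq] <;> omega
      _ ≤ _ := measure_finSep_mul_le_union_left _ _ _ _
      _ ≤ _ := by
          refine measure_mono ?_
          rintro ω ⟨A, hfin, hS, h⟩
          refine ⟨A, hfin, fun v hv => hS ?_, h⟩
          obtain ⟨h1, h2, h3⟩ := hv
          simp only [segment, Set.mem_union, Set.mem_ofPred_eq]
          omega
  have hlong : P long * P long ≤ P (topClosed N n) := by
    calc P long * P long
        ≤ P long * P (finSep (topEdges N) (segment N (-n) n) (belowLeft N (-n))) := by
          refine mul_le_mul_right ?_ _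
          refine measure_finSep_top_le_reflect hp0.le hp1 N ?_ ?_ <;> intro x y <;>
            simp only [segment, belowRight, belowLeft, Set.mem_ofPred_eq] <;> omega
      _ ≤ _ := measure_finSep_mul_le_union_right _ _ _ _
  have hsub : {ω | ∃ k : ℕ, Relation.ReflTransGen (UpperDualStep N (toG ω)) (n, N) (-1 - k, N)} ⊆
      short ∪ long := by
    rintro ω ⟨k, hk⟩
    obtain ⟨A, hfin, hN, hrow, hA⟩ := exists_finite_closedAt hk
    have hA' : ∀ e ∈ topEdges N, ClosedAt near far ω A e :=
      fun e he => closedAt_near_far.2 (hA e he)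
    have hrow' : ∀ v : ℤ × ℤ, v.2 = N → (v ∈ A ↔ -1 - (k : ℤ) < v.1 ∧ v.1 ≤ n) := by
      rintro ⟨x, y⟩ rfl
      exact hrow x
    rcases le_total k n with hkn | hkn
    · refine Or.inl ⟨A, hfin, ?_, ?_, hA'⟩
      · rintro v ⟨hv, h1, h2⟩
        rw [hrow' v hv]
        omega
      · refine Set.disjoint_left.2 fun v hv hB => ?_
        have h1 := hN v hv
        have h2 := hrow' v
        simp only [belowRight, belowLeft, Set.mem_union, Set.mem_ofPred_eq] at hB
        have hv2 : v.2 = N := by omega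
        have := (h2 hv2).1 hv
        omega
    · refine Or.inr ⟨A, hfin, ?_, ?_, hA'⟩
      · rintro v ⟨hv, h1, h2⟩
        rw [hrow' v hv]
        omega
      · refine Set.disjoint_left.2 fun v hv hB => ?_
        have h1 := hN v hv
        have h2 := hrow' v
        simp only [belowRight, Set.mem_ofPred_eq] at hB
        have hv2 : v.2 = N := by omega
        have := (h2 hv2).1 hv
        omega
  have hsum : thetaNE (1 - p) * thetaNE (1 - p) ≤ P short + P long :=
    (thetaNE_sq_le_measure_arc hp0 hp1 n N).trans
      ((measure_mono hsub).trans (measure_union_le _ _))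
  rcases le_total (P short) (P long) with hle | hle
  · have : thetaNE (1 - p) * thetaNE (1 - p) / 2 ≤ P long :=
      ENNReal.div_le_of_le_mul' (hsum.trans (by rw [two_mul]; gcongr))
    exact (mul_le_mul' this this).trans hlong
  · have : thetaNE (1 - p) * thetaNE (1 - p) / 2 ≤ P short :=
      ENNReal.div_le_of_le_mul' (hsum.trans (by rw [two_mul]; gcongr))
    exact (mul_le_mul' this this).trans hshort

lemma measure_topClosed_le_bottomClosed (hp0 : 0 ≤ p) (hp1 : p ≤ 1) (N n : ℕ) :
    Measure.infinitePi (fun _ : Edge => bern p) (topClosed N n) ≤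
      Measure.infinitePi (fun _ : Edge => bern p) (bottomClosed N n) :=
  measure_finSep_le_of_symmetry hp0 hp1 reflY_involutive (ρ := fun v => (v.1, -v.2))
    (fun v => by simp) near_reflY far_reflY _ _ _

end Measure

lemma snd_of_mem_topEdges {N : ℤ} {e : Edge} (he : e ∈ topEdges N) :
    N ≤ (near e).2 ∧ N ≤ (far e).2 := by
  obtain ⟨⟨x, y⟩, _ | _⟩ := e <;> simp only [topEdges, near, far, eSrc, eDst, Set.mem_ofPred_eq,
    if_true, Bool.false_eq_true, if_false] at * <;> split_ifs <;> constructor <;> dsimp only <;>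
    omega

lemma ClosedAt.congr_set {ω : Config} {A A' : Set (ℤ × ℤ)} {e : Edge}
    (h : ClosedAt near far ω A e) (hn : near e ∈ A' ↔ near e ∈ A) (hf : far e ∈ A' ↔ far e ∈ A) :
    ClosedAt near far ω A' e := by
  rwa [ClosedAt, hn, hf]

/-- The horizontal edges leaving the rectangle of width `2n` and height `2N` sideways. -/
noncomputable def sideEdges (N n : ℕ) : Finset Edge :=
  (({(n : ℤ), -(n : ℤ) - 1} : Finset ℤ) ×ˢ Finset.Icc (-(N : ℤ)) N) ×ˢ {false}

lemma mem_sideEdges {N n : ℕ} {e : Edge} :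
    e ∈ sideEdges N n ↔
      ((e.1.1 = n ∨ e.1.1 = -n - 1) ∧ -(N : ℤ) ≤ e.1.2 ∧ e.1.2 ≤ N) ∧ e.2 = false := by
  simp only [sideEdges, Finset.mem_product, Finset.mem_Icc, Finset.mem_singleton,
    Finset.mem_insert]

lemma mem_finSep_box {N n : ℕ} (hn : N ≤ n) {ω : Config}
    (hside : ∀ e ∈ sideEdges N n, ω e = false) (htop : ω ∈ topClosed N n)
    (hbot : ω ∈ bottomClosed N n) : ω ∈ finSep Set.univ (box N) ∅ := by
  obtain ⟨T, hTfin, hTS, hTB, hT⟩ := htop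
  obtain ⟨L, hLfin, hLS, hLB, hL⟩ := hbot
  have hT1 : ∀ v ∈ T, (N : ℤ) ≤ v.2 := fun v hv => by
    have := Set.disjoint_left.1 hTB hv
    simp only [belowRight, belowLeft, Set.mem_union, Set.mem_ofPred_eq] at this
    omega
  have hT2 : ∀ v : ℤ × ℤ, v.2 = N → (v ∈ T ↔ -(n : ℤ) ≤ v.1 ∧ v.1 ≤ n) := fun v hv => by
    refine ⟨fun h => ?_, fun h => hTS ⟨hv, h⟩⟩
    have := Set.disjoint_left.1 hTB h
    simp only [belowRight, belowLeft, Set.mem_union, Set.mem_ofPred_eq] at this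
    omega
  have hL1 : ∀ v ∈ L, v.2 ≤ -(N : ℤ) := fun v hv => by
    have := Set.disjoint_left.1 hLB hv
    simp only [belowRight, belowLeft, Set.mem_union, Set.mem_ofPred_eq, Set.mem_preimage] at this
    omega
  have hL2 : ∀ v : ℤ × ℤ, v.2 = -N → (v ∈ L ↔ -(n : ℤ) ≤ v.1 ∧ v.1 ≤ n) := fun v hv => by
    refine ⟨fun h => ?_, fun h => hLS ⟨by dsimp only; omega, h⟩⟩
    have := Set.disjoint_left.1 hLB h
    simp only [belowRight, belowLeft, Set.mem_union, Set.mem_ofPred_eq, Set.mem_preimage] at this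
    omega
  set R : Set (ℤ × ℤ) := {v | (-(n : ℤ) ≤ v.1 ∧ v.1 ≤ n) ∧ -(N : ℤ) ≤ v.2 ∧ v.2 ≤ N} with hR
  have hAtop : ∀ v : ℤ × ℤ, (N : ℤ) ≤ v.2 → (v ∈ T ∪ L ∪ R ↔ v ∈ T) := by
    intro v hv
    have h1 := hL1 v
    have h2 := hL2 v
    have h3 := hT2 v
    simp only [hR, Set.mem_union, Set.mem_ofPred_eq]
    refine ⟨?_, fun h => Or.inl (Or.inl h)⟩
    rintro ((h | h) | h)
    · exact h
    · have := h1 h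
      rw [h3 (by omega), ← h2 (by omega)]
      exact h
    · rw [h3 (by omega)]
      exact h.1
  have hAbot : ∀ v : ℤ × ℤ, v.2 ≤ -(N : ℤ) → (v ∈ T ∪ L ∪ R ↔ v ∈ L) := by
    intro v hv
    have h1 := hT1 v
    have h2 := hL2 v
    have h3 := hT2 v
    simp only [hR, Set.mem_union, Set.mem_ofPred_eq]
    refine ⟨?_, fun h => Or.inl (Or.inr h)⟩
    rintro ((h | h) | h)
    · have := h1 h
      rw [h2 (by omega), ← h3 (by omega)]
      exact h
    · exact h
    · rw [h2 (by omega)]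
      exact h.1
  have hAmid : ∀ v : ℤ × ℤ, -(N : ℤ) ≤ v.2 → v.2 ≤ N →
      (v ∈ T ∪ L ∪ R ↔ -(n : ℤ) ≤ v.1 ∧ v.1 ≤ n) := by
    intro v hv hv'
    refine ⟨?_, fun h => Or.inr ⟨h, hv, hv'⟩⟩
    rintro ((h | h) | h)
    · have := hT1 v h
      exact (hT2 v (by omega)).1 h
    · have := hL1 v h
      exact (hL2 v (by omega)).1 h
    · exact h.1
  have hRfin : R.Finite :=
    ((Set.finite_Icc (-(n : ℤ)) n).prod (Set.finite_Icc (-(N : ℤ)) N)).subset fun v hv => hv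
  refine ⟨T ∪ L ∪ R, (hTfin.union hLfin).union hRfin, ?_, Set.disjoint_empty _, fun e _ => ?_⟩
  · rintro v ⟨h1, h2⟩
    rw [hAmid v (by omega) (by omega)]
    omega
  by_cases het : e ∈ topEdges N
  · have h := snd_of_mem_topEdges het
    exact (hT e het).congr_set (hAtop _ h.1) (hAtop _ h.2)
  by_cases heb : e ∈ reflY ⁻¹' topEdges N
  · have h := snd_of_mem_topEdges heb
    rw [near_reflY, far_reflY] at h
    dsimp only at h
    exact (hL e heb).congr_set (hAbot _ (by omega)) (hAbot _ (by omega))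
  obtain ⟨⟨x, y⟩, _ | _⟩ := e
  · simp only [topEdges, reflY, Set.mem_preimage, Set.mem_ofPred_eq, Bool.false_eq_true,
      if_false] at het heb
    have hs := hAmid (x, y) (by dsimp only; omega) (by dsimp only; omega)
    have ht := hAmid (x + 1, y) (by dsimp only; omega) (by dsimp only; omega)
    dsimp only at hs ht
    by_cases hx : x = n ∨ x = -n - 1
    · have hω := hside ((x, y), false) (mem_sideEdges.2 ⟨⟨hx, by dsimp only; omega⟩, rfl⟩)
      refine ⟨fun h => by simp [hω] at h, fun _ _ => ?_⟩
      simp only [near, PointsOut, eSrc, eDst, Bool.false_eq_true, if_false]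
      split_ifs
      · rw [hs]; omega
      · rw [ht]; omega
    · rw [closedAt_near_far]
      simp only [ClosedAt, eSrc, eDst, Bool.false_eq_true, if_false]
      rw [hs, ht]
      omega
  · simp only [topEdges, reflY, Set.mem_preimage, Set.mem_ofPred_eq, if_true] at het heb
    have hs := hAmid (x, y) (by dsimp only; omega) (by dsimp only; omega)
    have ht := hAmid (x, y + 1) (by dsimp only; omega) (by dsimp only; omega)
    dsimp only at hs ht
    rw [closedAt_near_far]
    simp only [ClosedAt, eSrc, eDst, if_true]
    rw [hs, ht]
    omega

lemma determinedBy_finSep_box (N : ℕ) :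
    DeterminedBy (finSep Set.univ (box (N + 1)) ∅) {e | e.1 ∈ box N}ᶜ := by
  rintro ω ω' h ⟨A, hfin, hS, hB, hA⟩
  refine ⟨A, hfin, hS, hB, fun e he => ?_⟩
  by_cases heN : e.1 ∈ box N
  · have hsrc : eSrc e ∈ A := hS (box_mono (by omega) heN)
    have hdst : eDst e ∈ A := by
      refine hS ?_
      have h1 := heN.1
      have h2 := heN.2
      unfold eDst
      split_ifs <;> constructor <;> dsimp only <;> omega
    rw [closedAt_near_far]
    exact ⟨fun _ _ => hdst, fun _ _ => hsrc⟩
  · exact (hA e he).congr (h e heN)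

lemma antitone_finSep_box : Antitone fun N => finSep Set.univ (box N) ∅ := by
  rintro N N' h ω ⟨A, hfin, hS, h'⟩
  exact ⟨A, hfin, (box_mono h).trans hS, h'⟩

lemma not_percolates_of_mem_finSep {ω : Config} {N : ℕ} (h : ω ∈ finSep Set.univ (box N) ∅) :
    ¬ percolates (hStep ω) Set.univ := by
  rintro ⟨γ, h0, hinj, hstep, -⟩
  obtain ⟨A, hfin, hS, -, hA⟩ := h
  refine Set.infinite_range_of_injective hinj (hfin.subset ?_)
  rintro _ ⟨n, rfl⟩
  induction n with
  | zero => exact hS (by simp [h0, box])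
  | succ n ih =>
    exact mem_of_gStep (gStep_toG_of_hStep (hstep n))
      (fun e => closedAt_near_far.1 (hA e (Set.mem_univ e))) ih

section Measure

variable {p : ℝ}

lemma measure_exists_side (hp0 : 0 ≤ p) (hp1 : p < 1) (N : ℕ) :
    Measure.infinitePi (fun _ : Edge => bern p)
      (⋃ j, {ω | ∀ e ∈ sideEdges N (N + j), ω e = false}) = 1 := by
  have := isProbabilityMeasure_bern hp0 hp1.le
  refine measure_iUnion_eq_one (S := fun j => sideEdges N (N + j))
    (c := ENNReal.ofReal (1 - p) ^ (2 * (Finset.Icc (-(N : ℤ)) N).card))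
    ?_ (fun j => (determinedBy_forall_eq_false _).measurableSet)
    (fun j => determinedBy_forall_eq_false _) ?_ fun j => ?_
  · intro j j' hne
    refine Set.disjoint_left.2 fun e he he' => hne ?_
    have h := (mem_sideEdges.1 he).1.1
    have h' := (mem_sideEdges.1 he').1.1
    push_cast at h h'
    omega
  · exact pow_ne_zero _ (by simpa using hp1)
  · rw [measure_forall_eq_false hp0 hp1.le]
    refine pow_le_pow_right_of_le_one' (by simpa using hp0) ?_
    rw [sideEdges, Finset.card_product, Finset.card_product, Finset.card_singleton, mul_one]
    exact Nat.mul_le_mul_right _ Finset.card_le_two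

lemma measure_finSep_box_ge (hp0 : 0 < p) (hp1 : p < 1) {c : ℝ≥0∞}
    (hc : ∀ N n, c ≤ Measure.infinitePi (fun _ : Edge => bern p) (topClosed N n)) (N : ℕ) :
    c * c ≤ Measure.infinitePi (fun _ : Edge => bern p) (finSep Set.univ (box N) ∅) := by
  have := isProbabilityMeasure_bern hp0.le hp1.le
  calc c * c = Measure.infinitePi (fun _ : Edge => bern p)
        (⋃ j, {ω | ∀ e ∈ sideEdges N (N + j), ω e = false}) * (c * c) := by
        rw [measure_exists_side hp0.le hp1, one_mul]
    _ ≤ Measure.infinitePi (fun _ : Edge => bern p)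
        (⋃ j, {ω | ∀ e ∈ sideEdges N (N + j), ω e = false} ∩
          (topClosed N (N + j) ∩ bottomClosed N (N + j))) := by
        refine mul_le_measure_iUnion_inter
          (S := {e : Edge | e.2 = false ∧ -(N : ℤ) ≤ e.1.2 ∧ e.1.2 ≤ N})
          (T := topEdges N ∪ reflY ⁻¹' topEdges N) ?_
          (fun j => (determinedBy_forall_eq_false _).measurableSet)
          (fun j => (determinedBy_forall_eq_false _).mono fun e he => ?_)
          (fun j => (measurableSet_finSep _ _ _).inter (measurableSet_finSep _ _ _))
          (fun j => ((determinedBy_finSep _ _ _).mono Set.subset_union_left).inter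
            ((determinedBy_finSep _ _ _).mono Set.subset_union_right)) fun j => ?_
        · refine Set.disjoint_left.2 ?_
          rintro ⟨⟨x, y⟩, b⟩ ⟨rfl, h1, h2⟩ h
          simp only [topEdges, reflY, Set.mem_union, Set.mem_preimage, Set.mem_ofPred_eq,
            Bool.false_eq_true, if_false] at *
          omega
        · have h := mem_sideEdges.1 he
          exact ⟨h.2, h.1.2⟩
        · rw [measure_inter_of_disjoint (S := topEdges N) (T := reflY ⁻¹' topEdges N) ?_
            (measurableSet_finSep _ _ _) (determinedBy_finSep _ _ _)
            (measurableSet_finSep _ _ _) (determinedBy_finSep _ _ _)]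
          · exact mul_le_mul' (hc _ _)
              ((hc _ _).trans (measure_topClosed_le_bottomClosed hp0.le hp1.le _ _))
          · refine Set.disjoint_left.2 ?_
            rintro ⟨⟨x, y⟩, _ | _⟩ h1 h2 <;>
              simp only [topEdges, reflY, Set.mem_preimage, Set.mem_ofPred_eq, if_true,
                Bool.false_eq_true, if_false] at * <;> omega
    _ ≤ _ := measure_mono (Set.iUnion_subset fun j ω hω =>
        mem_finSep_box (Nat.le_add_right N j) hω.1 hω.2.1 hω.2.2)

/-- If large boxes are enclosed by finite closed sets with probability bounded below then almost
surely all of them are. -/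
lemma measure_iInter_finSep_box (hp0 : 0 ≤ p) (hp1 : p ≤ 1) {c : ℝ≥0∞} (hc0 : c ≠ 0)
    (hc : ∀ N, c ≤ Measure.infinitePi (fun _ : Edge => bern p) (finSep Set.univ (box N) ∅)) :
    Measure.infinitePi (fun _ : Edge => bern p) (⋂ N, finSep Set.univ (box N) ∅) = 1 := by
  have := isProbabilityMeasure_bern hp0 hp1
  have hmeas : ∀ N, MeasurableSet (finSep Set.univ (box N) ∅) := fun N => measurableSet_finSep _ _ _
  refine (measure_eq_zero_or_one_of_tail (.iInter hmeas) fun F => ?_).resolve_left fun h0 => ?_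
  · obtain ⟨M, hM⟩ := exists_subset_box (F.finite_toSet.image fun e => e.1)
    have heq : (⋂ N, finSep Set.univ (box N) ∅) = ⋂ N, finSep Set.univ (box (M + N + 1)) ∅ := by
      refine Set.Subset.antisymm (Set.subset_iInter fun N => Set.iInter_subset _ _)
        (Set.subset_iInter fun N => (Set.iInter_subset _ N).trans ?_)
      exact antitone_finSep_box (by omega)
    rw [heq]
    refine .iInter fun N => (determinedBy_finSep_box (M + N)).mono ?_
    rw [Set.compl_subset_compl]
    exact fun e he => box_mono (by omega) (hM (Set.mem_image_of_mem _ he))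
  · have hlim := tendsto_measure_iInter_atTop (μ := Measure.infinitePi (fun _ : Edge => bern p))
      (fun N => (hmeas N).nullMeasurableSet) antitone_finSep_box ⟨0, measure_ne_top _ _⟩
    rw [h0] at hlim
    exact hc0 (le_zero_iff.1 (ge_of_tendsto' hlim hc))

lemma ae_forall_eq_false : ∀ᵐ ω ∂Measure.infinitePi (fun _ : Edge => bern 0), ∀ e, ω e = false := by
  have := isProbabilityMeasure_bern le_rfl zero_le_one
  refine ae_all_iff.2 fun e => ?_
  refine (mem_ae_iff_prob_eq_one (measurableSet_apply_eq e false)).2 ?_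
  have h := measure_forall_eq_false le_rfl zero_le_one {e}
  simpa using h

end Measure

lemma not_percolates_gStep_of_forall_eq_false {η : Config} (h : ∀ e, η e = false) :
    ¬ percolates (gStep η) NEquad := by
  rintro ⟨γ, h0, -, hstep, hNE⟩
  obtain ⟨⟨⟨x, y⟩, b⟩, ⟨-, -, he⟩ | ⟨h1, h2, -⟩⟩ := hstep 0
  · simp [h] at he
  · have h3 := hNE 1
    rw [zero_add] at h1
    rw [← h1] at h3
    rw [h0] at h2
    cases b <;> simp [eSrc, eDst, NEquad] at h2 h3 <;> omega

lemma not_percolates_hStep_of_forall_eq_false {ω : Config} (h : ∀ e, ω e = false) :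
    ¬ percolates (hStep ω) Set.univ := by
  rintro ⟨γ, h0, hinj, hstep, -⟩
  obtain ⟨e, -, he⟩ := hstep 0
  rw [h, h0, eq_comm, decide_eq_false_iff_not] at he
  refine hinj.ne one_ne_zero (Prod.ext ?_ ?_) <;> rw [h0] <;> simp [normSq] at he ⊢ <;> nlinarith

/-- If the NE-quadrant random-orientation model with parameter `1 - p` percolates,
then the H-model with parameter `p` does not percolate. -/
theorem thetaH_eq_zero_of_thetaNE_one_sub_pos (p : ℝ) (hp0 : 0 ≤ p) (hp1 : p ≤ 1)
    (h : 0 < thetaNE (1 - p)) : thetaH p = 0 := by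
  rw [thetaH, mu, bernoulliProduct_eq hp0 hp1]
  rcases hp0.eq_or_lt with rfl | hp0'
  · rw [measure_eq_zero_iff_ae_notMem]
    filter_upwards [ae_forall_eq_false] with ω hω
    exact not_percolates_hStep_of_forall_eq_false hω
  rcases hp1.eq_or_lt with rfl | hp1'
  · refine absurd ?_ h.ne'
    rw [sub_self, thetaNE, mu, bernoulliProduct_eq le_rfl zero_le_one,
      measure_eq_zero_iff_ae_notMem]
    filter_upwards [ae_forall_eq_false] with η hη
    exact not_percolates_gStep_of_forall_eq_false hη
  have := isProbabilityMeasure_bern hp0 hp1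
  have hhalf : thetaNE (1 - p) * thetaNE (1 - p) / 2 ≠ 0 := by
    simp [h.ne']
  have hone := measure_iInter_finSep_box hp0 hp1
    (mul_ne_zero (mul_ne_zero hhalf hhalf) (mul_ne_zero hhalf hhalf))
    (measure_finSep_box_ge hp0' hp1' (measure_topClosed_ge hp0' hp1))
  have hae : ∀ᵐ ω ∂Measure.infinitePi (fun _ : Edge => bern p),
      ω ∈ ⋂ N, finSep Set.univ (box N) ∅ :=
    (mem_ae_iff_prob_eq_one (.iInter fun N => measurableSet_finSep _ _ _)).2 hone
  rw [measure_eq_zero_iff_ae_notMem]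
  filter_upwards [hae] with ω hω
  exact not_percolates_of_mem_finSep (Set.mem_iInter.1 hω 0)

end RandomOrientation
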